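/- arXiv:math/0303350 — 2 statements merged into one kernel-verified Lean document; each statement's English description precedes it below -/
import Mathlib

section
/- Under the standing hypotheses on H, let u : [t₀,t₁] × 𝕋 → ℝ be continuous, locally Lipschitz on (t₀,t₁] × 𝕋, satisfy ∂_t u + H(t,x,c+∂_x u) = 0 almost everywhere, and suppose there is a nonincreasing K : (t₀,t₁] → (0,∞) such that u_t is K(t)-semi-concave for all t ∈ (t₀,t₁]. If (S,Q) ∈ (t₀,t₁] × 𝕋 is a point where the partial derivative ∂_x u exists, then u is differentiable at (S,Q) and ∂_t u(S,Q) + H(S,Q,c+∂_x u(S,Q)) = 0. -/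
open MeasureTheory Filter Set Topology

noncomputable section

/-- The Hamiltonian vector field `X(t,x,p) = (∂_p H, -∂_x H)` on `𝕋 × ℝ` (lifted to `ℝ × ℝ`). -/
def HamVF (H : ℝ → ℝ → ℝ → ℝ) (t : ℝ) (z : ℝ × ℝ) : ℝ × ℝ :=
  (deriv (fun p => H t z.1 p) z.2, - deriv (fun x => H t x z.2) z.1)

/-- The standing hypotheses on the Hamiltonian `H`, with the circle `𝕋 = ℝ/ℤ` modelled by
`1`-periodicity in the space variable `x`. -/
structure BurgersHyp (H : ℝ → ℝ → ℝ → ℝ) : Prop where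
  smooth : ContDiff ℝ 2 (fun q : ℝ × ℝ × ℝ => H q.1 q.2.1 q.2.2)
  per_t : ∀ t x p, H (t + 1) x p = H t x p
  per_x : ∀ t x p, H t (x + 1) p = H t x p
  convexp : ∀ t x p, 0 < iteratedDeriv 2 (fun q => H t x q) p
  superlinear : ∀ t x, Tendsto (fun p => H t x p / |p|) (Bornology.cobounded ℝ) atTop
  complete : ∀ t₀ : ℝ, ∀ z₀ : ℝ × ℝ,
    ∃ γ : ℝ → ℝ × ℝ, γ t₀ = z₀ ∧ ∀ t, HasDerivAt γ (HamVF H t (γ t)) t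

/-- The Lagrangian associated to `H` by Legendre duality. -/
def Lag (H : ℝ → ℝ → ℝ → ℝ) (t x v : ℝ) : ℝ := sSup (range fun p => p * v - H t x p)

/-- `ξ` is absolutely continuous on `[a,b]` with (a.e.) derivative `g`. -/
def IsAC (ξ g : ℝ → ℝ) (a b : ℝ) : Prop :=
  IntervalIntegrable g volume a b ∧ ∀ t ∈ Icc a b, ξ t = ξ a + ∫ s in a..t, g s

/-- The set of values over which the Hopf–Lax–Oleinik infimum is taken. -/
def hloSet (H : ℝ → ℝ → ℝ → ℝ) (c a b : ℝ) (u : ℝ → ℝ) (x : ℝ) : Set ℝ :=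
  {v | ∃ ξ g : ℝ → ℝ, IsAC ξ g a b ∧ ξ b = x ∧
    IntervalIntegrable (fun s => Lag H s (ξ s) (g s) - c * g s) volume a b ∧
    v = u (ξ a) + ∫ s in a..b, (Lag H s (ξ s) (g s) - c * g s)}

/-- The Hopf–Lax–Oleinik operator `V^c_{a,b}`. -/
def hlo (H : ℝ → ℝ → ℝ → ℝ) (c a b : ℝ) (u : ℝ → ℝ) (x : ℝ) : ℝ := sInf (hloSet H c a b u x)

/-- Viscosity subsolution of `∂_t u + H(t,x,c+∂_x u) = a` on `D`. -/
def ViscSubSol (H : ℝ → ℝ → ℝ → ℝ) (c a : ℝ) (D : Set (ℝ × ℝ)) (u : ℝ → ℝ → ℝ) : Prop :=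
  ∀ φ : ℝ × ℝ → ℝ, ContDiff ℝ 1 φ → ∀ z ∈ D,
    IsLocalMax (fun w : ℝ × ℝ => u w.1 w.2 - φ w) z →
    fderiv ℝ φ z (1, 0) + H z.1 z.2 (c + fderiv ℝ φ z (0, 1)) ≤ a

/-- Viscosity supersolution of `∂_t u + H(t,x,c+∂_x u) = a` on `D`. -/
def ViscSuperSol (H : ℝ → ℝ → ℝ → ℝ) (c a : ℝ) (D : Set (ℝ × ℝ)) (u : ℝ → ℝ → ℝ) : Prop :=
  ∀ φ : ℝ × ℝ → ℝ, ContDiff ℝ 1 φ → ∀ z ∈ D,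
    IsLocalMin (fun w : ℝ × ℝ => u w.1 w.2 - φ w) z →
    a ≤ fderiv ℝ φ z (1, 0) + H z.1 z.2 (c + fderiv ℝ φ z (0, 1))

/-- Viscosity solution (Crandall–Lions) of `∂_t u + H(t,x,c+∂_x u) = a` on `D`. -/
def ViscSol (H : ℝ → ℝ → ℝ → ℝ) (c a : ℝ) (D : Set (ℝ × ℝ)) (u : ℝ → ℝ → ℝ) : Prop :=
  ViscSubSol H c a D u ∧ ViscSuperSol H c a D u

/-- Viscosity solution of `(HJc)` on `[t₀,∞) × 𝕋`: continuous up to `t₀`, `1`-periodic in `x`,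
and a viscosity solution for `t > t₀`. -/
def IsViscSolOn (H : ℝ → ℝ → ℝ → ℝ) (c t₀ : ℝ) (u : ℝ → ℝ → ℝ) : Prop :=
  ContinuousOn (fun z : ℝ × ℝ => u z.1 z.2) (Ici t₀ ×ˢ univ) ∧
  (∀ t x, u t (x + 1) = u t x) ∧
  ViscSol H c 0 (Ioi t₀ ×ˢ univ) u

/-- `w` is `K`-semi-concave: `∂_xx w ≤ K` in the sense of distributions. -/
def SemiConcaveK (w : ℝ → ℝ) (K : ℝ) : Prop :=
  ConcaveOn ℝ univ (fun x => w x - K * x ^ 2 / 2)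

/-- The class `ℰ`: functions that are (locally) the sum of a continuous and a
nonincreasing function. -/
def EClass (f : ℝ → ℝ) : Prop :=
  ∃ g h : ℝ → ℝ, Continuous g ∧ Antitone h ∧ ∀ x, f x = g x + h x

/-- Right limit `f⁻(x)`. -/
def rlim (f : ℝ → ℝ) (q : ℝ) : ℝ := limUnder (nhdsWithin q (Ioi q)) f

/-- Left limit `f⁺(x)`. -/
def llim (f : ℝ → ℝ) (q : ℝ) : ℝ := limUnder (nhdsWithin q (Iio q)) f

def Gminus (f : ℝ → ℝ) : Set (ℝ × ℝ) := {z | z.2 = rlim f z.1}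
def Gplus (f : ℝ → ℝ) : Set (ℝ × ℝ) := {z | z.2 = llim f z.1}

/-- The graph `G(f) = G⁻(f) ∩ G⁺(f)`. -/
def Ggraph (f : ℝ → ℝ) : Set (ℝ × ℝ) := Gminus f ∩ Gplus f

/-- The closure of the graph, `G⁻(f) ∪ G⁺(f)`. -/
def Gbar (f : ℝ → ℝ) : Set (ℝ × ℝ) := Gminus f ∪ Gplus f

/-- The Jordan curve `H(f) = ⋃_x {x} × [f⁻(x), f⁺(x)]` (one period). -/
def Hset (f : ℝ → ℝ) : Set (ℝ × ℝ) :=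
  {z | z.1 ∈ Icc (0:ℝ) 1 ∧ z.2 ∈ Icc (rlim f z.1) (llim f z.1)}

/-- Entropy solution of `∂_t y + ∂_x (H(t,x,y)) = 0` on `[t₀,∞) × 𝕋` (with its own
initial trace at `t₀`): distributional solution satisfying the Oleinik inequalities. -/
def IsEntropySolOn (H : ℝ → ℝ → ℝ → ℝ) (t₀ : ℝ) (y : ℝ → ℝ → ℝ) : Prop :=
  (∀ t x, t₀ ≤ t → y t (x + 1) = y t x) ∧
  (∀ T, t₀ < T →
    IntegrableOn (fun z : ℝ × ℝ => y z.1 z.2) (Icc t₀ T ×ˢ Icc (0:ℝ) 1) volume ∧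
    IntegrableOn (fun z : ℝ × ℝ => H z.1 z.2 (y z.1 z.2)) (Icc t₀ T ×ˢ Icc (0:ℝ) 1) volume) ∧
  (∀ φ : ℝ × ℝ → ℝ, ContDiff ℝ 2 φ → (∀ t x, φ (t, x + 1) = φ (t, x)) →
    (∃ T, ∀ t x, T ≤ t → φ (t, x) = 0) →
    (∫ z in Ioi t₀ ×ˢ Ioc (0:ℝ) 1,
      (y z.1 z.2 * fderiv ℝ φ z (1, 0) + H z.1 z.2 (y z.1 z.2) * fderiv ℝ φ z (0, 1)))
      + ∫ x in (0:ℝ)..1, y t₀ x * φ (t₀, x) = 0) ∧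
  (∃ K : ℝ → ℝ, (∀ t, t₀ < t → 0 < K t) ∧ AntitoneOn K (Ioi t₀) ∧
    ∀ t, t₀ < t → ∀ x δ, 0 < δ → y t (x + δ) - y t x ≤ K t * δ)

/-- `ξ` (with a.e. derivative `g`) is calibrated by `u` on `[a,b]`. -/
def CalibratedCurve (H : ℝ → ℝ → ℝ → ℝ) (c : ℝ) (u : ℝ → ℝ → ℝ)
    (ξ g : ℝ → ℝ) (a b : ℝ) : Prop :=
  IsAC ξ g a b ∧
  IntervalIntegrable (fun s => Lag H s (ξ s) (g s) - c * g s) volume a b ∧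
  u b (ξ b) = u a (ξ a) + ∫ s in a..b, (Lag H s (ξ s) (g s) - c * g s)

/-- `φ t₀ t` is the (lifted) flow of the Hamiltonian vector field of `H` between times
`t₀` and `t`. -/
def IsHamFlow (H : ℝ → ℝ → ℝ → ℝ) (φ : ℝ → ℝ → ℝ × ℝ → ℝ × ℝ) : Prop :=
  (∀ t₀ z, φ t₀ t₀ z = z) ∧
  (∀ t₀ z t, HasDerivAt (fun s => φ t₀ s z) (HamVF H t (φ t₀ t z)) t) ∧
  (∀ t₀ t, Function.Bijective (φ t₀ t)) ∧
  (∀ t₀ t z, φ t₀ t (z + ((1:ℝ), (0:ℝ))) = φ t₀ t z + ((1:ℝ), (0:ℝ)))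

/-- Periodic, measurable, integrable over a period: a representative of an element of
`L¹(𝕋)`. -/
def PerInt (y : ℝ → ℝ) : Prop :=
  (∀ x, y (x + 1) = y x) ∧ Measurable y ∧ IntervalIntegrable y volume 0 1

/-- `E` is the time-one entropy evolution operator of `H` (extended to `L¹(𝕋)` by
`L¹`-continuity; it is considered up to a.e. equality, and satisfies the Oleinik bound). -/
structure IsEntropyOp (H : ℝ → ℝ → ℝ → ℝ) (E : (ℝ → ℝ) → (ℝ → ℝ)) : Prop where
  sol : ∀ y₀ : ℝ → ℝ, PerInt y₀ → (∃ M, ∀ x, |y₀ x| ≤ M) →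
    ∃ y : ℝ → ℝ → ℝ, IsEntropySolOn H 0 y ∧ (∀ x, y 0 x = y₀ x) ∧ (∀ x, E y₀ x = y 1 x)
  maps : ∀ y, PerInt y → PerInt (E y)
  oleinik : ∀ y, PerInt y → ∃ K, 0 < K ∧ ∀ x δ, 0 < δ → E y (x + δ) - E y x ≤ K * δ
  cont : ∀ y : ℝ → ℝ, PerInt y → ∀ z : ℕ → ℝ → ℝ, (∀ n, PerInt (z n)) →
    Tendsto (fun n => ∫ x in (0:ℝ)..1, |z n x - y x|) atTop (𝓝 0) →
    Tendsto (fun n => ∫ x in (0:ℝ)..1, |E (z n) x - E y x|) atTop (𝓝 0)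

/-- Mather's alpha function: `C¹`, convex, superlinear, and every viscosity solution `u`
of `(HJc)` has `u + tα(c)` bounded. -/
def MatherAlpha (H : ℝ → ℝ → ℝ → ℝ) (α : ℝ → ℝ) : Prop :=
  ContDiff ℝ 1 α ∧ ConvexOn ℝ univ α ∧
  Tendsto (fun c => α c / |c|) (Bornology.cobounded ℝ) atTop ∧
  ∀ c t₀ : ℝ, ∀ u : ℝ → ℝ → ℝ, IsViscSolOn H c t₀ u →
    ∃ M, ∀ t ∈ Ici t₀, ∀ x, |u t x + t * α c| ≤ M

end

/-- Increments of a semi-concave function near `Q` are controlled by its increments over two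
reference intervals on either side of `Q`. -/
lemma SemiConcaveK.increment_bounds {w : ℝ → ℝ} {K Q r x y : ℝ} (hw : SemiConcaveK w K)
    (hK : 0 ≤ K) (hr : 0 < r) (hx : Q - r < x) (hxy : x < y) (hy : y < Q + r) :
    (y - x) * ((w (Q + 2 * r) - w (Q + r)) / r - 5 / 2 * K * r) ≤ w y - w x ∧
      w y - w x ≤ (y - x) * ((w (Q - r) - w (Q - 2 * r)) / r + 5 / 2 * K * r) := by
  have hconc : ConcaveOn ℝ univ (fun x => w x - K * x ^ 2 / 2) := hw
  have hyx : 0 < y - x := by linarith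
  have slope : (w y - K * y ^ 2 / 2 - (w x - K * x ^ 2 / 2)) / (y - x)
      = (w y - w x) / (y - x) - K * (x + y) / 2 := by
    field_simp
    ring
  constructor
  · have h1 := hconc.slope_anti_adjacent (mem_univ x) (mem_univ (Q + r)) hxy hy
    have h2 := hconc.slope_anti_adjacent (mem_univ y) (mem_univ (Q + 2 * r)) hy
      (by linarith : Q + r < Q + 2 * r)
    have h3 := h2.trans h1
    have ref : (w (Q + 2 * r) - K * (Q + 2 * r) ^ 2 / 2 - (w (Q + r) - K * (Q + r) ^ 2 / 2))
        / (Q + 2 * r - (Q + r)) = (w (Q + 2 * r) - w (Q + r)) / r - K * (Q + 3 / 2 * r) := by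
      rw [show Q + 2 * r - (Q + r) = r by ring]
      field_simp
      ring
    rw [ref, slope] at h3
    have h4 : (w (Q + 2 * r) - w (Q + r)) / r - 5 / 2 * K * r ≤ (w y - w x) / (y - x) := by
      nlinarith [mul_nonneg hK (by linarith : 0 ≤ x + y - (2 * Q - 2 * r))]
    rw [le_div_iff₀ hyx] at h4
    linarith
  · have h1 := hconc.slope_anti_adjacent (mem_univ (Q - r)) (mem_univ y) hx hxy
    have h2 := hconc.slope_anti_adjacent (mem_univ (Q - 2 * r)) (mem_univ x)
      (by linarith : Q - 2 * r < Q - r) hx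
    have h3 := h1.trans h2
    have ref : (w (Q - r) - K * (Q - r) ^ 2 / 2 - (w (Q - 2 * r) - K * (Q - 2 * r) ^ 2 / 2))
        / (Q - r - (Q - 2 * r)) = (w (Q - r) - w (Q - 2 * r)) / r - K * (Q - 3 / 2 * r) := by
      rw [show Q - r - (Q - 2 * r) = r by ring]
      field_simp
      ring
    rw [ref, slope] at h3
    have h4 : (w y - w x) / (y - x) ≤ (w (Q - r) - w (Q - 2 * r)) / r + 5 / 2 * K * r := by
      nlinarith [mul_nonneg hK (by linarith : 0 ≤ 2 * Q + 2 * r - (x + y))]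
    rw [div_le_iff₀ hyx] at h4
    linarith

/-- If `w` is uniformly semi-concave along a filter and converges pointwise to a function having
derivative `p` at `Q`, then the slopes of `w` near `Q` are eventually close to `p`. -/
lemma eventually_abs_increment_sub_le {ι : Type*} {l : Filter ι} {w : ι → ℝ → ℝ} {w₀ : ℝ → ℝ}
    {K Q p : ℝ} (hK : 0 ≤ K) (hw : ∀ᶠ i in l, SemiConcaveK (w i) K)
    (hlim : ∀ x, Tendsto (fun i => w i x) l (𝓝 (w₀ x))) (hp : HasDerivAt w₀ p Q)
    {ε : ℝ} (hε : 0 < ε) :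
    ∃ r > 0, ∀ᶠ i in l, ∀ x ∈ Ioo (Q - r) (Q + r), ∀ y ∈ Ioo (Q - r) (Q + r),
      |w i y - w i x - p * (y - x)| ≤ ε * |y - x| := by
  have hd := (hasDerivAt_iff_isLittleO.1 hp).bound (show (0:ℝ) < ε / 16 by positivity)
  obtain ⟨δ, hδ, hball⟩ := Metric.eventually_nhds_iff.1 hd
  obtain ⟨r, hr, hrδ, hrK⟩ : ∃ r > 0, 2 * r < δ ∧ 5 / 2 * K * r ≤ ε / 2 := by
    refine ⟨min (δ / 3) (ε / (5 * (K + 1))), by positivity, ?_, ?_⟩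
    · linarith [min_le_left (δ / 3) (ε / (5 * (K + 1)))]
    · have h := min_le_right (δ / 3) (ε / (5 * (K + 1)))
      have h0 : 0 ≤ min (δ / 3) (ε / (5 * (K + 1))) := by positivity
      rw [le_div_iff₀ (by positivity)] at h
      nlinarith
  have key : ∀ h : ℝ, |h| ≤ 2 * r → |w₀ (Q + h) - w₀ Q - p * h| ≤ ε / 8 * r := by
    intro h hh
    have := @hball (Q + h) (by simpa [Real.dist_eq] using hh.trans_lt hrδ)
    simp only [smul_eq_mul, Real.norm_eq_abs, add_sub_cancel_left] at this
    rw [mul_comm h p] at this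
    nlinarith
  have near : ∀ x, ∀ᶠ i in l, |w i x - w₀ x| < ε / 16 * r := fun x =>
    (hlim x).eventually (Metric.ball_mem_nhds (w₀ x) (by positivity))
  refine ⟨r, hr, ?_⟩
  filter_upwards [hw, near (Q + r), near (Q + 2 * r), near (Q - r), near (Q - 2 * r)]
    with i hi h1 h2 h3 h4
  have lower : p - ε ≤ (w i (Q + 2 * r) - w i (Q + r)) / r - 5 / 2 * K * r := by
    have e1 := key (2 * r) (by rw [abs_of_pos (by positivity)])
    have e2 := key r (by rw [abs_of_pos hr]; linarith)
    have : p - ε / 2 ≤ (w i (Q + 2 * r) - w i (Q + r)) / r := by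
      rw [le_div_iff₀ hr]
      rw [abs_le] at e1 e2
      rw [abs_lt] at h1 h2
      nlinarith
    linarith
  have upper : (w i (Q - r) - w i (Q - 2 * r)) / r + 5 / 2 * K * r ≤ p + ε := by
    have e1 := key (-(2 * r)) (by rw [abs_neg, abs_of_pos (by positivity)])
    have e2 := key (-r) (by rw [abs_neg, abs_of_pos hr]; linarith)
    rw [← sub_eq_add_neg] at e1 e2
    have : (w i (Q - r) - w i (Q - 2 * r)) / r ≤ p + ε / 2 := by
      rw [div_le_iff₀ hr]
      rw [abs_le] at e1 e2
      rw [abs_lt] at h3 h4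
      nlinarith
    linarith
  have ordered : ∀ x y, Q - r < x → x < y → y < Q + r →
      |w i y - w i x - p * (y - x)| ≤ ε * |y - x| := by
    intro x y hx hxy hy
    obtain ⟨hl, hu⟩ := hi.increment_bounds hK hr hx hxy hy
    have hyx : 0 < y - x := by linarith
    rw [abs_of_pos hyx, abs_le]
    constructor <;> nlinarith
  intro x hx y hy
  rcases lt_trichotomy x y with h | rfl | h
  · exact ordered x y hx.1 h hy.2
  · simp
  · rw [abs_sub_comm y x, ← abs_neg]
    convert ordered y x hy.1 h hx.2 using 2
    ring

/-- Mean value inequality for a Lipschitz function whose derivative is controlled almost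
everywhere. -/
lemma LipschitzOnWith.abs_sub_sub_mul_le {g : ℝ → ℝ} {a b m ε : ℝ} {C : NNReal} (hab : a ≤ b)
    (hg : LipschitzOnWith C g (Icc a b))
    (h : ∀ᵐ t, t ∈ Ioo a b → |deriv g t - m| ≤ ε) :
    |g b - g a - m * (b - a)| ≤ ε * (b - a) := by
  rw [← uIcc_of_le hab] at hg
  have hac := hg.absolutelyContinuousOnInterval
  have hint : ∫ t in a..b, (deriv g t - m) = g b - g a - m * (b - a) := by
    rw [intervalIntegral.integral_sub hac.intervalIntegrable_deriv (by simp),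
      hac.integral_deriv_eq_sub]
    simp [mul_comm]
  rw [← hint, ← Real.norm_eq_abs]
  have hb : ∀ᵐ t : ℝ, t ≠ b := by simp [ae_iff]
  have := intervalIntegral.norm_integral_le_of_norm_le_const_ae (a := a) (b := b)
    (f := fun t => deriv g t - m) (C := ε) (by
      filter_upwards [h, hb] with t ht htb hmem
      rw [uIoc_of_le hab] at hmem
      exact ht ⟨hmem.1, lt_of_le_of_ne hmem.2 htb⟩)
  rwa [abs_of_nonneg (sub_nonneg.2 hab)] at this

/-- Semi-concavity is monotone in the constant. -/
lemma SemiConcaveK.mono {w : ℝ → ℝ} {K K' : ℝ} (hw : SemiConcaveK w K) (h : K ≤ K') :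
    SemiConcaveK w K' := by
  have hsq : ConvexOn ℝ univ (fun x : ℝ => (K' - K) / 2 * x ^ 2) :=
    (Even.convexOn_pow (n := 2) even_two).smul (by linarith : 0 ≤ (K' - K) / 2)
  have hw' : ConcaveOn ℝ univ (fun x => w x - K * x ^ 2 / 2) := hw
  refine (hw'.sub hsq).congr fun x _ => ?_
  simp only [Pi.sub_apply]
  ring

/-- Vertical increments along an a.e. solution: if the slopes of `u t` are close to `p` near
`(S, Q)`, then the increments in time are governed by `-H(S, Q, c + p)`. -/
lemma abs_time_increment_le {H : ℝ → ℝ → ℝ → ℝ}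
    (hH : Continuous (fun q : ℝ × ℝ × ℝ => H q.1 q.2.1 q.2.2)) {c t₀ t₁ : ℝ} {u : ℝ → ℝ → ℝ}
    (hcont : ∀ t ∈ Ioc t₀ t₁, Continuous (u t)) {S Q p : ℝ}
    (hS : S ∈ Ioc t₀ t₁)
    (hlip : ∃ C : NNReal, ∃ s ∈ 𝓝[Ioc t₀ t₁ ×ˢ (univ : Set ℝ)] (S, Q),
        LipschitzOnWith C (fun w : ℝ × ℝ => u w.1 w.2) s)
    (hae : ∀ᵐ z ∂(volume.restrict (Ioo t₀ t₁ ×ˢ (univ : Set ℝ))),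
      DifferentiableAt ℝ (fun w : ℝ × ℝ => u w.1 w.2) z ∧
      fderiv ℝ (fun w : ℝ × ℝ => u w.1 w.2) z (1, 0)
        + H z.1 z.2 (c + fderiv ℝ (fun w : ℝ × ℝ => u w.1 w.2) z (0, 1)) = 0)
    (hslope : ∀ ε > 0, ∃ r > 0, ∀ᶠ t in 𝓝[Ioc t₀ t₁] S,
      ∀ x ∈ Ioo (Q - r) (Q + r), ∀ y ∈ Ioo (Q - r) (Q + r),
        |u t y - u t x - p * (y - x)| ≤ ε * |y - x|) {ε : ℝ} (hε : 0 < ε) :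
    ∃ δ > 0, ∀ t ∈ Ioc t₀ t₁, |t - S| < δ → ∀ x, |x - Q| < δ →
      |u t x - u S x + H S Q (c + p) * (t - S)| ≤ ε * |t - S| := by
  obtain ⟨η, hη, hHη⟩ := Metric.continuousAt_iff.1 (hH.continuousAt (x := (S, Q, c + p))) ε hε
  obtain ⟨r, hr, hev⟩ := hslope (η / 2) (by positivity)
  obtain ⟨δ₁, hδ₁, hslope'⟩ := Metric.eventually_nhds_iff.1 (eventually_nhdsWithin_iff.1 hev)
  obtain ⟨C, s, hs, hLip⟩ := hlip
  obtain ⟨ρ, hρ, hsub⟩ := Metric.mem_nhdsWithin_iff.1 hs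
  obtain ⟨δ, hδ, hδη, hδr, hδδ₁, hδρ⟩ :
      ∃ δ > 0, δ ≤ η ∧ δ ≤ r ∧ δ ≤ δ₁ ∧ δ ≤ ρ :=
    ⟨min (min η r) (min δ₁ ρ), by positivity, by simp, by simp, by simp, by simp⟩
  refine ⟨δ, hδ, ?_⟩
  have deriv_close : ∀ t ∈ Ioo t₀ t₁, |t - S| < δ → ∀ x, |x - Q| < δ →
      DifferentiableAt ℝ (fun w : ℝ × ℝ => u w.1 w.2) (t, x) →
      fderiv ℝ (fun w : ℝ × ℝ => u w.1 w.2) (t, x) (1, 0)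
        + H t x (c + fderiv ℝ (fun w : ℝ × ℝ => u w.1 w.2) (t, x) (0, 1)) = 0 →
      |deriv (fun τ => u τ x) t - -H S Q (c + p)| ≤ ε := by
    intro t ht htS x hxQ hdiff heq
    have dt : HasDerivAt (fun τ => u τ x)
        (fderiv ℝ (fun w : ℝ × ℝ => u w.1 w.2) (t, x) (1, 0)) t :=
      hdiff.hasFDerivAt.comp_hasDerivAt (f := fun τ : ℝ => (τ, x)) t
        ((hasDerivAt_id t).prodMk (hasDerivAt_const t x))
    have dx : HasDerivAt (fun y => u t y)
        (fderiv ℝ (fun w : ℝ × ℝ => u w.1 w.2) (t, x) (0, 1)) x :=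
      hdiff.hasFDerivAt.comp_hasDerivAt (f := fun y : ℝ => (t, y)) x
        ((hasDerivAt_const x t).prodMk (hasDerivAt_id x))
    have hxr : x ∈ Ioo (Q - r) (Q + r) := by
      rw [abs_lt] at hxQ
      constructor <;> linarith
    have dxp := (dx.sub ((hasDerivAt_id x).const_mul p)).le_of_lip' (C := η / 2) (by positivity)
      (by
        filter_upwards [Ioo_mem_nhds hxr.1 hxr.2] with y hy
        have := hslope' (show dist t S < δ₁ by rw [Real.dist_eq]; linarith)
          ⟨ht.1, ht.2.le⟩ x hxr y hy
        simp only [Real.norm_eq_abs, Pi.sub_apply, id]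
        convert this using 2
        ring)
    rw [Real.norm_eq_abs, mul_one] at dxp
    have hHc := @hHη (t, x, c + fderiv ℝ (fun w : ℝ × ℝ => u w.1 w.2) (t, x) (0, 1)) (by
      rw [Prod.dist_eq, Prod.dist_eq, max_lt_iff, max_lt_iff]
      simp only [Real.dist_eq, add_sub_add_left_eq_sub]
      exact ⟨by linarith, by linarith, by linarith⟩)
    rw [Real.dist_eq] at hHc
    rw [dt.deriv, eq_neg_of_add_eq_zero_left heq, neg_sub_neg, abs_sub_comm]
    exact hHc.le
  have hae' : ∀ᵐ x : ℝ, ∀ᵐ t : ℝ, t ∈ Ioo t₀ t₁ →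
      DifferentiableAt ℝ (fun w : ℝ × ℝ => u w.1 w.2) (t, x) ∧
      fderiv ℝ (fun w : ℝ × ℝ => u w.1 w.2) (t, x) (1, 0)
        + H t x (c + fderiv ℝ (fun w : ℝ × ℝ => u w.1 w.2) (t, x) (0, 1)) = 0 := by
    rw [ae_restrict_iff' (measurableSet_Ioo.prod MeasurableSet.univ)] at hae
    have h := (Measure.measurePreserving_swap (μ := (volume : Measure ℝ))
      (ν := (volume : Measure ℝ))).quasiMeasurePreserving.ae hae
    filter_upwards [Measure.ae_ae_of_ae_prod h] with x hx
    filter_upwards [hx] with t ht htI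
    exact ht ⟨htI, mem_univ _⟩
  have good : ∀ᵐ x : ℝ, |x - Q| < δ → ∀ a ∈ Ioc t₀ t₁, ∀ b ∈ Ioc t₀ t₁, |a - S| < δ →
      |b - S| < δ → a ≤ b → |u b x - u a x + H S Q (c + p) * (b - a)| ≤ ε * (b - a) := by
    filter_upwards [hae'] with x hx hxQ a ha b hb haS hbS hab
    rw [abs_lt] at haS hbS
    have hL : LipschitzOnWith C (fun τ => u τ x) (Icc a b) := by
      have hmaps : MapsTo (fun τ : ℝ => (τ, x)) (Icc a b) s := by
        intro τ hτ
        refine hsub ⟨?_, ⟨ha.1.trans_le hτ.1, hτ.2.trans hb.2⟩, mem_univ _⟩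
        rw [Metric.mem_ball, Prod.dist_eq, max_lt_iff]
        refine ⟨?_, by simpa [Real.dist_eq] using hxQ.trans_le hδρ⟩
        rw [Real.dist_eq, abs_lt]
        constructor <;> linarith [hτ.1, hτ.2]
      rw [← mul_one C]
      exact hLip.comp (LipschitzWith.prodMk_right x).lipschitzOnWith hmaps
    have := hL.abs_sub_sub_mul_le (m := -H S Q (c + p)) (ε := ε) hab (by
      filter_upwards [hx] with t ht htab
      have htI : t ∈ Ioo t₀ t₁ := ⟨ha.1.trans htab.1, htab.2.trans_le hb.2⟩
      exact deriv_close t htI (by rw [abs_lt]; constructor <;> linarith [htab.1, htab.2])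
        x hxQ (ht htI).1 (ht htI).2)
    rwa [neg_mul, sub_neg_eq_add] at this
  intro t ht htS x hxQ
  have hclosed : IsClosed {y | |u t y - u S y + H S Q (c + p) * (t - S)| ≤ ε * |t - S|} :=
    isClosed_le (((hcont t ht).sub (hcont S hS)).add continuous_const).abs continuous_const
  refine closure_minimal ?_ hclosed
    ((Measure.dense_of_ae good).open_subset_closure_inter Metric.isOpen_ball
      (show x ∈ Metric.ball Q δ by rwa [Metric.mem_ball, Real.dist_eq]))
  rintro y ⟨hyQ, hy⟩
  rw [Metric.mem_ball, Real.dist_eq] at hyQ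
  have hSS : |S - S| < δ := by simpa using hδ
  rcases le_total S t with h | h
  · rw [mem_ofPred_eq, abs_of_nonneg (sub_nonneg.2 h)]
    exact hy hyQ S hS t ht hSS htS h
  · rw [mem_ofPred_eq, abs_sub_comm t S, abs_of_nonneg (sub_nonneg.2 h), ← abs_neg]
    convert hy hyQ t ht S hS htS hSS h using 2
    ring

/-- if `u` satisfies condition (ii) (locally Lipschitz, equation a.e.,
semi-concavity) and the partial derivative `∂_x u` exists at `(S,Q)`, then `u` is
differentiable at `(S,Q)` and satisfies the equation there. -/
theorem stmt_3 (H : ℝ → ℝ → ℝ → ℝ) (hH : BurgersHyp H) (c t₀ t₁ : ℝ) (h01 : t₀ < t₁)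
    (u : ℝ → ℝ → ℝ)
    (hcont : ContinuousOn (fun z : ℝ × ℝ => u z.1 z.2) (Icc t₀ t₁ ×ˢ univ))
    (hper : ∀ t x, u t (x + 1) = u t x)
    (hlip : ∀ z ∈ Ioc t₀ t₁ ×ˢ (univ : Set ℝ), ∃ K : NNReal,
      ∃ s ∈ 𝓝[Ioc t₀ t₁ ×ˢ (univ : Set ℝ)] z,
        LipschitzOnWith K (fun w : ℝ × ℝ => u w.1 w.2) s)
    (hae : ∀ᵐ z ∂(volume.restrict (Ioo t₀ t₁ ×ˢ (univ : Set ℝ))),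
      DifferentiableAt ℝ (fun w : ℝ × ℝ => u w.1 w.2) z ∧
      fderiv ℝ (fun w : ℝ × ℝ => u w.1 w.2) z (1, 0)
        + H z.1 z.2 (c + fderiv ℝ (fun w : ℝ × ℝ => u w.1 w.2) z (0, 1)) = 0)
    (hsc : ∃ K : ℝ → ℝ, AntitoneOn K (Ioc t₀ t₁) ∧
      ∀ t ∈ Ioc t₀ t₁, 0 < K t ∧ SemiConcaveK (u t) (K t))
    (S Q : ℝ) (hS : S ∈ Ioc t₀ t₁) (hx : DifferentiableAt ℝ (u S) Q) :
    ∃ L : ℝ × ℝ →L[ℝ] ℝ,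
      HasFDerivWithinAt (fun w : ℝ × ℝ => u w.1 w.2) L (Ioc t₀ t₁ ×ˢ (univ : Set ℝ)) (S, Q) ∧
      L (0, 1) = deriv (u S) Q ∧
      L (1, 0) + H S Q (c + deriv (u S) Q) = 0 := by
  obtain ⟨K, hKanti, hK⟩ := hsc
  have hτ : (t₀ + S) / 2 ∈ Ioc t₀ t₁ := ⟨by linarith [hS.1], by linarith [hS.1, hS.2]⟩
  have hsemi : ∀ᶠ t in 𝓝[Ioc t₀ t₁] S, SemiConcaveK (u t) (K ((t₀ + S) / 2)) := by
    filter_upwards [self_mem_nhdsWithin,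
      mem_nhdsWithin_of_mem_nhds (Ioi_mem_nhds (show (t₀ + S) / 2 < S by linarith [hS.1]))]
      with t ht hlt
    exact (hK t ht).2.mono (hKanti hτ ht (le_of_lt hlt))
  have hlim : ∀ x, Tendsto (fun t => u t x) (𝓝[Ioc t₀ t₁] S) (𝓝 (u S x)) := fun x =>
    (hcont.comp (f := fun t : ℝ => (t, x)) (s := Ioc t₀ t₁) (by fun_prop)
      (fun t ht => ⟨Ioc_subset_Icc_self ht, mem_univ _⟩)) S hS
  have hcontx : ∀ t ∈ Ioc t₀ t₁, Continuous (u t) := fun t ht =>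
    hcont.comp_continuous (f := fun x : ℝ => (t, x)) (by fun_prop)
      (fun x => ⟨Ioc_subset_Icc_self ht, mem_univ _⟩)
  have hslope := fun (ε : ℝ) (hε : ε > 0) =>
    eventually_abs_increment_sub_le (hK _ hτ).1.le hsemi hlim hx.hasDerivAt hε
  refine ⟨(-H S Q (c + deriv (u S) Q)) • ContinuousLinearMap.fst ℝ ℝ ℝ
    + deriv (u S) Q • ContinuousLinearMap.snd ℝ ℝ ℝ, ?_, by simp, by simp⟩
  rw [hasFDerivWithinAt_iff_isLittleO, Asymptotics.isLittleO_iff]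
  intro ε hε
  obtain ⟨δ, hδ, htime⟩ := abs_time_increment_le hH.smooth.continuous (c := c) hcontx hS
    (hlip (S, Q) ⟨hS, mem_univ _⟩) hae hslope (half_pos hε)
  obtain ⟨δ', hδ', hspace⟩ := Metric.eventually_nhds_iff.1
    ((hasDerivAt_iff_isLittleO.1 hx.hasDerivAt).bound (half_pos hε))
  filter_upwards [self_mem_nhdsWithin,
    mem_nhdsWithin_of_mem_nhds (Metric.ball_mem_nhds (S, Q) (lt_min hδ hδ'))]
  rintro ⟨t, x⟩ ⟨ht, -⟩ hball
  rw [Metric.mem_ball, Prod.dist_eq, max_lt_iff, Real.dist_eq, Real.dist_eq] at hball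
  have h1 := htime t ht (hball.1.trans_le (min_le_left _ _)) x
    (hball.2.trans_le (min_le_left _ _))
  have h2 := @hspace x (by rw [Real.dist_eq]; exact hball.2.trans_le (min_le_right _ _))
  rw [Real.norm_eq_abs, Real.norm_eq_abs, smul_eq_mul] at h2
  have hn1 : |t - S| ≤ ‖(t, x) - (S, Q)‖ := norm_fst_le ((t, x) - (S, Q))
  have hn2 : |x - Q| ≤ ‖(t, x) - (S, Q)‖ := norm_snd_le ((t, x) - (S, Q))
  calc _ = |(u t x - u S x + H S Q (c + deriv (u S) Q) * (t - S))
        + (u S x - u S Q - (x - Q) * deriv (u S) Q)| := by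
        rw [Real.norm_eq_abs]
        congr 1
        simp only [Prod.mk_sub_mk, add_apply, smul_apply, ContinuousLinearMap.coe_fst',
          ContinuousLinearMap.coe_snd', smul_eq_mul]
        ring
    _ ≤ ε / 2 * |t - S| + ε / 2 * |x - Q| := (abs_add_le _ _).trans (add_le_add h1 h2)
    _ ≤ ε * ‖(t, x) - (S, Q)‖ := by nlinarith
end

section
/- Under the standing hypotheses on H, let u : [t₀,∞) × 𝕋 → ℝ be a viscosity solution of ∂_t u + H(t,x,c+∂_x u) = 0 and let α(c) ∈ ℝ be such that (t,x) ↦ u(t,x) + tα(c) is bounded on [t₀,∞) × 𝕋. Then the function v : 𝕋 × 𝕋 → ℝ defined by v(θ,x) = liminf_{t → ∞, t mod 1 = θ} ( u(t,x) − (−tα(c)) ), i.e. v(θ,x) = liminf over t ≥ t₀ with t ≡ θ (mod 1) of u(t,x) + tα(c), is a viscosity solution of the time-periodic Hamilton–Jacobi equation ∂_θ v + H(θ,x,c+∂_x v) = α(c) on 𝕋 × 𝕋. -/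
open MeasureTheory Filter Set Topology

/-- Viscosity supersolutions of `∂_t w + G(t,x,∂_x w) = 0` for `t > t₀`. -/
def VSupersol (G : ℝ × ℝ → ℝ → ℝ) (t₀ : ℝ) (w : ℝ × ℝ → ℝ) : Prop :=
  ∀ φ : ℝ × ℝ → ℝ, ContDiff ℝ 1 φ → ∀ z : ℝ × ℝ, t₀ < z.1 →
    IsLocalMin (fun y => w y - φ y) z →
    0 ≤ fderiv ℝ φ z (1, 0) + G z (fderiv ℝ φ z (0, 1))

theorem fderiv_apply_fst_of_hasDerivAt {φ : ℝ × ℝ → ℝ} {z : ℝ × ℝ} {d : ℝ}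
    (h : DifferentiableAt ℝ φ z) (hd : HasDerivAt (fun t => φ (t, z.2)) d z.1) :
    fderiv ℝ φ z (1, 0) = d := by
  have h1 : HasDerivAt (fun t : ℝ => ((t, z.2) : ℝ × ℝ)) (1, 0) z.1 :=
    (hasDerivAt_id z.1).prodMk (hasDerivAt_const z.1 z.2)
  exact (h.hasFDerivAt.comp_hasDerivAt z.1 h1).unique hd

theorem fderiv_apply_snd_of_hasDerivAt {φ : ℝ × ℝ → ℝ} {z : ℝ × ℝ} {d : ℝ}
    (h : DifferentiableAt ℝ φ z) (hd : HasDerivAt (fun x => φ (z.1, x)) d z.2) :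
    fderiv ℝ φ z (0, 1) = d := by
  have h1 : HasDerivAt (fun x : ℝ => ((z.1, x) : ℝ × ℝ)) (0, 1) z.2 :=
    (hasDerivAt_const z.2 z.1).prodMk (hasDerivAt_id z.2)
  exact (h.hasFDerivAt.comp_hasDerivAt z.2 h1).unique hd

theorem hasDerivAt_fst_of_differentiableAt {φ : ℝ × ℝ → ℝ} {z : ℝ × ℝ}
    (h : DifferentiableAt ℝ φ z) :
    HasDerivAt (fun t => φ (t, z.2)) (fderiv ℝ φ z (1, 0)) z.1 := by
  have h1 : HasDerivAt (fun t : ℝ => ((t, z.2) : ℝ × ℝ)) (1, 0) z.1 :=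
    (hasDerivAt_id z.1).prodMk (hasDerivAt_const z.1 z.2)
  exact h.hasFDerivAt.comp_hasDerivAt z.1 h1

theorem hasDerivAt_snd_of_differentiableAt {φ : ℝ × ℝ → ℝ} {z : ℝ × ℝ}
    (h : DifferentiableAt ℝ φ z) :
    HasDerivAt (fun x => φ (z.1, x)) (fderiv ℝ φ z (0, 1)) z.2 := by
  have h1 : HasDerivAt (fun x : ℝ => ((z.1, x) : ℝ × ℝ)) (0, 1) z.2 :=
    (hasDerivAt_const z.2 z.1).prodMk (hasDerivAt_id z.2)
  exact h.hasFDerivAt.comp_hasDerivAt z.2 h1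

/-- The viscosity inequality only requires a minimum over the past. -/
theorem VSupersol.of_isLocalMinOn {G : ℝ × ℝ → ℝ → ℝ} {t₀ : ℝ} {w : ℝ × ℝ → ℝ}
    (hG : Continuous fun q : (ℝ × ℝ) × ℝ => G q.1 q.2)
    (hw : ContinuousOn w {z | t₀ < z.1}) (h : VSupersol G t₀ w) {φ : ℝ × ℝ → ℝ}
    (hφ : ContDiff ℝ 1 φ) {z : ℝ × ℝ} (hz : t₀ < z.1)
    (hmin : IsLocalMinOn (fun y => w y - φ y) {y | y.1 ≤ z.1} z) :
    0 ≤ fderiv ℝ φ z (1, 0) + G z (fderiv ℝ φ z (0, 1)) := by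
  by_contra! hneg
  have hdφ : Continuous (fderiv ℝ φ) := hφ.continuous_fderiv one_ne_zero
  set Ψ : ℝ × ℝ → ℝ := fun y => fderiv ℝ φ y (1, 0) - 2 * (y.1 - z.1) +
    G y (fderiv ℝ φ y (0, 1) - 2 * (y.2 - z.2)) with hΨ
  have hΨc : Continuous Ψ := by
    have h1 : Continuous fun y => fderiv ℝ φ y (1, 0) := hdφ.clm_apply continuous_const
    have h2 : Continuous fun y => fderiv ℝ φ y (0, 1) := hdφ.clm_apply continuous_const
    have h3 : Continuous fun y : ℝ × ℝ =>
        G y (fderiv ℝ φ y (0, 1) - 2 * (y.2 - z.2)) :=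
      hG.comp (continuous_id.prodMk (by fun_prop))
    simp only [hΨ]; fun_prop
  have hΨz : Ψ z < 0 := by simpa [hΨ] using hneg
  have e1 : ∀ᶠ y in 𝓝 z, Ψ y < 0 := hΨc.continuousAt.eventually_lt_const hΨz
  have e2 : ∀ᶠ y : ℝ × ℝ in 𝓝 z, t₀ < y.1 :=
    continuous_fst.continuousAt.eventually_const_lt hz
  have e3 : ∀ᶠ y : ℝ × ℝ in 𝓝 z, y.1 ≤ z.1 → w z - φ z ≤ w y - φ y := by
    have := hmin
    rw [IsLocalMinOn, IsMinFilter, eventually_nhdsWithin_iff] at this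
    exact this
  obtain ⟨r, hr, hball⟩ := Metric.nhds_basis_closedBall.eventually_iff.1
    (e1.and (e2.and e3))
  set s : ℝ × ℝ → ℝ := fun y => (y.1 - z.1) ^ 2 + (y.2 - z.2) ^ 2 with hs
  set m := min (r ^ 2) 1 with hm
  have hm0 : 0 < m := lt_min (by positivity) one_pos
  have hzmem : ∀ σ, 0 ≤ σ → σ ≤ r → ((z.1 - σ, z.2) : ℝ × ℝ) ∈ Metric.closedBall z r := by
    intro σ h0 h1
    rw [Metric.mem_closedBall, Prod.dist_eq, Real.dist_eq, Real.dist_eq]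
    simp [abs_of_nonneg h0, h1, hr.le]
  -- a good earlier time
  have hwz : ContinuousAt w z := hw.continuousAt (e2)
  have hcont : ContinuousAt (fun σ : ℝ => w (z.1 - σ, z.2) - φ (z.1 - σ, z.2) + σ ^ 2) 0 := by
    have h1 : ContinuousAt (fun σ : ℝ => ((z.1 - σ, z.2) : ℝ × ℝ)) 0 := by fun_prop
    have h2 : ContinuousAt (fun σ : ℝ => w (z.1 - σ, z.2)) 0 :=
      ContinuousAt.comp (g := w) (by simpa using hwz) h1
    have h3 : ContinuousAt (fun σ : ℝ => φ (z.1 - σ, z.2)) 0 :=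
      (hφ.continuous.continuousAt).comp h1
    exact (h2.sub h3).add (continuousAt_id.pow 2)
  have e4 : ∀ᶠ σ in 𝓝 (0 : ℝ),
      w (z.1 - σ, z.2) - φ (z.1 - σ, z.2) + σ ^ 2 < w z - φ z + m / 2 :=
    hcont.eventually_lt_const (by simp; exact hm0)
  obtain ⟨d, hd, hd'⟩ := Metric.eventually_nhds_iff.1 e4
  set σ := min (d / 2) (r / 2) with hσ
  have hσ0 : 0 < σ := lt_min (by positivity) (by positivity)
  have hσr : σ < r := (min_le_right _ _).trans_lt (by linarith)
  have hσd : w (z.1 - σ, z.2) - φ (z.1 - σ, z.2) + σ ^ 2 < w z - φ z + m / 2 := by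
    apply hd'
    rw [Real.dist_eq, sub_zero, abs_of_pos hσ0]
    exact (min_le_left _ _).trans_lt (by linarith)
  obtain ⟨N, hN⟩ := exists_pow_lt_of_lt_one (half_pos hm0)
    (show (r - σ) / r < 1 by rw [div_lt_one hr]; linarith)
  set pen : ℝ × ℝ → ℝ := fun y => ((y.1 - z.1 + r) / r) ^ N with hpen
  set ψ : ℝ × ℝ → ℝ := fun y => φ y - s y - pen y with hψ
  have hψc : ContDiff ℝ 1 ψ := by
    simp only [hψ, hs, hpen]
    have : ContDiff ℝ 1 fun y : ℝ × ℝ => ((y.1 - z.1 + r) / r) ^ N := by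
      apply ContDiff.pow; fun_prop
    fun_prop
  set K := Metric.closedBall z r ∩ {y | y.1 ≤ z.1} with hK
  have hKc : IsCompact K :=
    (isCompact_closedBall z r).inter_right (isClosed_le continuous_fst continuous_const)
  have hwK : ContinuousOn (fun y => w y - ψ y) K :=
    (hw.mono fun y hy => (hball hy.1).2.1).sub hψc.continuous.continuousOn
  obtain ⟨y, hyK, hymin⟩ := hKc.exists_isMinOn ⟨z, by simp [hK, hr.le]⟩ hwK
  have hlow : w y - φ y + s y + pen y < w z - φ z + m := by
    have := hymin (show ((z.1 - σ, z.2) : ℝ × ℝ) ∈ K from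
      ⟨hzmem σ hσ0.le hσr.le, by simpa using hσ0.le⟩)
    simp only [mem_ofPred_eq, hψ, hs, hpen] at this hσd ⊢
    have e : z.1 - σ - z.1 + r = r - σ := by ring
    rw [e] at this
    have e' : (z.1 - σ - z.1) ^ 2 + (z.2 - z.2) ^ 2 = σ ^ 2 := by ring
    linarith
  have hyw := (hball hyK.1).2.2 hyK.2
  have hy1 : |y.1 - z.1| ≤ r ∧ |y.2 - z.2| ≤ r := by
    have := hyK.1
    rw [Metric.mem_closedBall, Prod.dist_eq, Real.dist_eq, Real.dist_eq] at this
    exact max_le_iff.1 this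
  have hy0 : 0 ≤ y.1 - z.1 + r := by linarith [(abs_le.1 hy1.1).1]
  have hpen0 : 0 ≤ pen y := by simp only [hpen]; positivity
  have hsum : s y + pen y < m := by linarith
  have hmr : m ≤ r ^ 2 := min_le_left _ _
  have hm1 : m ≤ 1 := min_le_right _ _
  have hlt1 : |y.1 - z.1| < r := by
    apply lt_of_pow_lt_pow_left₀ 2 hr.le
    rw [sq_abs]
    have : 0 ≤ (y.2 - z.2) ^ 2 := sq_nonneg _
    simp only [hs] at hsum; linarith
  have hlt2 : |y.2 - z.2| < r := by
    apply lt_of_pow_lt_pow_left₀ 2 hr.le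
    rw [sq_abs]
    have : 0 ≤ (y.1 - z.1) ^ 2 := sq_nonneg _
    simp only [hs] at hsum; linarith
  have hltt : y.1 < z.1 := by
    refine lt_of_le_of_ne hyK.2 fun heq => ?_
    have hp : pen y = 1 := by simp [hpen, heq, hr.ne']
    have : 0 ≤ s y := by simp only [hs]; positivity
    linarith
  have hloc : IsLocalMin (fun y => w y - ψ y) y := by
    apply hymin.isLocalMin
    have hb : Metric.ball z r ∈ 𝓝 y := Metric.isOpen_ball.mem_nhds (by
      rw [Metric.mem_ball, Prod.dist_eq, Real.dist_eq, Real.dist_eq]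
      exact max_lt hlt1 hlt2)
    have hb2 : {y : ℝ × ℝ | y.1 < z.1} ∈ 𝓝 y :=
      (isOpen_lt continuous_fst continuous_const).mem_nhds hltt
    filter_upwards [hb, hb2] with x hx hx2
    exact ⟨Metric.ball_subset_closedBall hx, le_of_lt hx2⟩
  have key := h ψ hψc y (hball hyK.1).2.1 hloc
  have hφd := (hφ.differentiable one_ne_zero) y
  have hψd := (hψc.differentiable one_ne_zero) y
  have d1 : fderiv ℝ ψ y (1, 0) = fderiv ℝ φ y (1, 0) - 2 * (y.1 - z.1)
      - N * ((y.1 - z.1 + r) / r) ^ (N - 1) * (1 / r) := by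
    apply fderiv_apply_fst_of_hasDerivAt hψd
    have a1 := hasDerivAt_fst_of_differentiableAt hφd
    have a2 : HasDerivAt (fun t : ℝ => (t - z.1) ^ 2 + (y.2 - z.2) ^ 2) (2 * (y.1 - z.1)) y.1 := by
      simpa using (((hasDerivAt_id y.1).sub_const z.1).pow 2).add_const ((y.2 - z.2) ^ 2)
    have a3 : HasDerivAt (fun t : ℝ => ((t - z.1 + r) / r) ^ N)
        (N * ((y.1 - z.1 + r) / r) ^ (N - 1) * (1 / r)) y.1 :=
      ((((hasDerivAt_id y.1).sub_const z.1).add_const r).div_const r).pow N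
    exact (a1.sub a2).sub a3
  have d2 : fderiv ℝ ψ y (0, 1) = fderiv ℝ φ y (0, 1) - 2 * (y.2 - z.2) := by
    apply fderiv_apply_snd_of_hasDerivAt hψd
    have a1 := hasDerivAt_snd_of_differentiableAt hφd
    have a2 : HasDerivAt (fun t : ℝ => (y.1 - z.1) ^ 2 + (t - z.2) ^ 2) (2 * (y.2 - z.2)) y.2 := by
      simpa using (((hasDerivAt_id y.2).sub_const z.2).pow 2).const_add ((y.1 - z.1) ^ 2)
    exact (a1.sub a2).sub_const (((y.1 - z.1 + r) / r) ^ N)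
  rw [d1, d2] at key
  have hp : 0 ≤ N * ((y.1 - z.1 + r) / r) ^ (N - 1) * (1 / r) := by positivity
  have := (hball hyK.1).1
  simp only [hΨ] at this
  linarith

noncomputable section

/-- The partial derivative `∂_p F` of a function of `(t, x, p)`. -/
def dP (F : ℝ × ℝ × ℝ → ℝ) (q : ℝ × ℝ × ℝ) : ℝ := fderiv ℝ F q (0, 0, 1)

/-- The partial derivative `∂_x F` of a function of `(t, x, p)`. -/
def dX (F : ℝ × ℝ × ℝ → ℝ) (q : ℝ × ℝ × ℝ) : ℝ := fderiv ℝ F q (0, 1, 0)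

/-- `γ` is an orbit of the Hamiltonian vector field of `F`. -/
def IsOrbit (F : ℝ × ℝ × ℝ → ℝ) (γ : ℝ → ℝ × ℝ) : Prop :=
  ∀ t, HasDerivAt γ (dP F (t, γ t), -dX F (t, γ t)) t

/-- Periodic Tonelli Hamiltonians with complete flow, in uncurried form. -/
structure Tonelli (F : ℝ × ℝ × ℝ → ℝ) : Prop where
  smooth : ContDiff ℝ 2 F
  per_t : ∀ t x p, F (t + 1, x, p) = F (t, x, p)
  per_x : ∀ t x p, F (t, x + 1, p) = F (t, x, p)
  pos : ∀ q, 0 < fderiv ℝ (dP F) q (0, 0, 1)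
  superlinear : ∀ t x, Tendsto (fun p => F (t, x, p) / |p|) (Bornology.cobounded ℝ) atTop
  complete : ∀ t₀ z₀, ∃ γ, γ t₀ = z₀ ∧ IsOrbit F γ

end

theorem hasDerivAt_p {F : ℝ × ℝ × ℝ → ℝ} {t x p : ℝ} (h : DifferentiableAt ℝ F (t, x, p)) :
    HasDerivAt (fun p => F (t, x, p)) (fderiv ℝ F (t, x, p) (0, 0, 1)) p := by
  have h1 : HasDerivAt (fun p : ℝ => ((t, x, p) : ℝ × ℝ × ℝ)) (0, 0, 1) p :=
    (hasDerivAt_const p t).prodMk ((hasDerivAt_const p x).prodMk (hasDerivAt_id p))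
  exact h.hasFDerivAt.comp_hasDerivAt p h1

theorem hasDerivAt_x {F : ℝ × ℝ × ℝ → ℝ} {t x p : ℝ} (h : DifferentiableAt ℝ F (t, x, p)) :
    HasDerivAt (fun x => F (t, x, p)) (fderiv ℝ F (t, x, p) (0, 1, 0)) x := by
  have h1 : HasDerivAt (fun x : ℝ => ((t, x, p) : ℝ × ℝ × ℝ)) (0, 1, 0) x :=
    (hasDerivAt_const x t).prodMk ((hasDerivAt_id x).prodMk (hasDerivAt_const x p))
  exact h.hasFDerivAt.comp_hasDerivAt x h1

namespace Tonelli

variable {F : ℝ × ℝ × ℝ → ℝ}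

theorem continuous (hF : Tonelli F) : Continuous F := hF.smooth.continuous

theorem differentiable (hF : Tonelli F) : Differentiable ℝ F :=
  hF.smooth.differentiable two_ne_zero

theorem contDiff_fderiv (hF : Tonelli F) : ContDiff ℝ 1 (fderiv ℝ F) :=
  hF.smooth.fderiv_right (by norm_num)

theorem contDiff_dP (hF : Tonelli F) : ContDiff ℝ 1 (dP F) :=
  hF.contDiff_fderiv.clm_apply contDiff_const

theorem contDiff_dX (hF : Tonelli F) : ContDiff ℝ 1 (dX F) :=
  hF.contDiff_fderiv.clm_apply contDiff_const

theorem hasDerivAt (hF : Tonelli F) (t x p : ℝ) :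
    HasDerivAt (fun p => F (t, x, p)) (dP F (t, x, p)) p :=
  hasDerivAt_p (hF.differentiable _)

theorem hasDerivAt_dP (hF : Tonelli F) (t x p : ℝ) :
    HasDerivAt (fun p => dP F (t, x, p)) (fderiv ℝ (dP F) (t, x, p) (0, 0, 1)) p :=
  hasDerivAt_p (hF.contDiff_dP.differentiable one_ne_zero _)

theorem strictMono_dP (hF : Tonelli F) (t x : ℝ) : StrictMono fun p => dP F (t, x, p) :=
  strictMono_of_deriv_pos fun p => by
    rw [(hF.hasDerivAt_dP t x p).deriv]; exact hF.pos _

theorem convexOn (hF : Tonelli F) (t x : ℝ) : ConvexOn ℝ univ fun p => F (t, x, p) := by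
  apply MonotoneOn.convexOn_of_deriv convex_univ
  · exact (hF.continuous.comp (by fun_prop)).continuousOn
  · exact fun p _ => (hF.hasDerivAt t x p).differentiableAt.differentiableWithinAt
  · have : deriv (fun p => F (t, x, p)) = fun p => dP F (t, x, p) :=
      funext fun p => (hF.hasDerivAt t x p).deriv
    rw [this]
    exact (hF.strictMono_dP t x).monotone.monotoneOn _

/-- Convexity: the graph lies above its tangents. -/
theorem tangent_le (hF : Tonelli F) (t x p q : ℝ) :
    F (t, x, p) + dP F (t, x, p) * (q - p) ≤ F (t, x, q) := by
  rcases lt_trichotomy p q with h | h | h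
  · have := (hF.convexOn t x).le_slope_of_hasDerivAt (mem_univ p) (mem_univ q) h
      (hF.hasDerivAt t x p)
    rw [slope_def_field, le_div_iff₀ (by linarith)] at this
    linarith
  · simp [h]
  · have := (hF.convexOn t x).slope_le_of_hasDerivAt (mem_univ q) (mem_univ p) h
      (hF.hasDerivAt t x p)
    rw [slope_def_field, div_le_iff₀ (by linarith)] at this
    linarith

/-- Second order Taylor estimates on balls. -/
theorem exists_taylor (hF : Tonelli F) (B : ℝ) : ∃ C, 0 ≤ C ∧
    ∀ a ∈ Metric.closedBall (0 : ℝ × ℝ × ℝ) B, ∀ b ∈ Metric.closedBall (0 : ℝ × ℝ × ℝ) B,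
      ‖fderiv ℝ F b - fderiv ℝ F a‖ ≤ C * ‖b - a‖ ∧
      ‖F b - F a - fderiv ℝ F a (b - a)‖ ≤ C * ‖b - a‖ ^ 2 := by
  have hK := isCompact_closedBall (0 : ℝ × ℝ × ℝ) B
  obtain ⟨C, hC⟩ := hK.exists_bound_of_continuousOn
    (hF.contDiff_fderiv.continuous_fderiv one_ne_zero).norm.continuousOn
  have key : ∀ a ∈ Metric.closedBall (0 : ℝ × ℝ × ℝ) B,
      ∀ b ∈ Metric.closedBall (0 : ℝ × ℝ × ℝ) B,
      ‖fderiv ℝ F b - fderiv ℝ F a‖ ≤ |C| * ‖b - a‖ := by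
    intro a ha b hb
    apply (convex_closedBall (0 : ℝ × ℝ × ℝ) B).norm_image_sub_le_of_norm_fderiv_le
      (𝕜 := ℝ) (fun x _ => hF.contDiff_fderiv.differentiable one_ne_zero x) _ ha hb
    intro x hx
    have := hC x hx
    rw [norm_norm] at this
    exact this.trans (le_abs_self C)
  refine ⟨|C|, abs_nonneg _, fun a ha b hb => ⟨key a ha b hb, ?_⟩⟩
  have hseg : segment ℝ a b ⊆ Metric.closedBall (0 : ℝ × ℝ × ℝ) B :=
    (convex_closedBall (0 : ℝ × ℝ × ℝ) B).segment_subset ha hb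
  have := (convex_segment a b).norm_image_sub_le_of_norm_hasFDerivWithin_le' (𝕜 := ℝ)
    (f := F) (f' := fderiv ℝ F) (φ := fderiv ℝ F a) (C := |C| * ‖b - a‖)
    (fun x _ => (hF.differentiable x).hasFDerivAt.hasFDerivWithinAt)
    (fun x hx => (key a ha x (hseg hx)).trans (by
      have : ‖x - a‖ ≤ ‖b - a‖ := by
        obtain ⟨α, β, h1, h2, h3, rfl⟩ := hx
        have : α • a + β • b - a = β • (b - a) := by
          rw [← eq_sub_iff_add_eq] at h3
          rw [h3]; module
        rw [this, norm_smul, Real.norm_of_nonneg h2]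
        exact mul_le_of_le_one_left (norm_nonneg _) (by linarith)
      gcongr)) (left_mem_segment ℝ a b) (right_mem_segment ℝ a b)
  rw [sq, ← mul_assoc]; exact this

/-- The Taylor estimate in the variables `(x, p)`. -/
theorem exists_taylor_xp (hF : Tonelli F) (B : ℝ) : ∃ C, 0 ≤ C ∧
    ∀ t x p z y : ℝ, |t| ≤ B → |x| ≤ B → |p| ≤ B → |x + z| ≤ B → |p + y| ≤ B →
      |F (t, x + z, p + y) - F (t, x, p) - dX F (t, x, p) * z - dP F (t, x, p) * y|
        ≤ C * (z ^ 2 + y ^ 2) ∧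
      |dP F (t, x + z, p) - dP F (t, x, p)| ≤ C * |z| := by
  obtain ⟨C, hC0, hC⟩ := hF.exists_taylor B
  have hmem : ∀ t x p : ℝ, |t| ≤ B → |x| ≤ B → |p| ≤ B →
      ((t, x, p) : ℝ × ℝ × ℝ) ∈ Metric.closedBall (0 : ℝ × ℝ × ℝ) B := by
    intro t x p h1 h2 h3
    rw [mem_closedBall_zero_iff, Prod.norm_def, Prod.norm_def]
    exact max_le h1 (max_le h2 h3)
  refine ⟨C, hC0, fun t x p z y ht hx hp hxz hpy => ⟨?_, ?_⟩⟩
  · have := (hC _ (hmem t x p ht hx hp) _ (hmem t (x + z) (p + y) ht hxz hpy)).2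
    have e : ((t, x + z, p + y) : ℝ × ℝ × ℝ) - (t, x, p) = z • (0, 1, 0) + y • (0, 0, 1) := by
      ext <;> simp
    have e2 : ‖((t, x + z, p + y) : ℝ × ℝ × ℝ) - (t, x, p)‖ ^ 2 ≤ z ^ 2 + y ^ 2 := by
      have : ‖((t, x + z, p + y) : ℝ × ℝ × ℝ) - (t, x, p)‖ = max |z| |y| := by
        simp [Prod.norm_def]
      rw [this]
      rcases max_cases |z| |y| with h | h <;> rw [h.1, sq_abs] <;>
        nlinarith [sq_nonneg z, sq_nonneg y]
    rw [e, map_add, map_smul, map_smul] at this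
    rw [e] at e2
    refine (le_of_eq ?_).trans (this.trans (by gcongr))
    rw [Real.norm_eq_abs]
    congr 1
    simp only [dX, dP, smul_eq_mul]; ring
  · have := (hC _ (hmem t x p ht hx hp) _ (hmem t (x + z) p ht hxz hp)).1
    have e : ‖((t, x + z, p) : ℝ × ℝ × ℝ) - (t, x, p)‖ = |z| := by simp [Prod.norm_def]
    rw [e] at this
    have h2 := (fderiv ℝ F (t, x + z, p) - fderiv ℝ F (t, x, p)).le_opNorm (0, 0, 1)
    have e1 : ‖((0, 0, 1) : ℝ × ℝ × ℝ)‖ = 1 := by simp [Prod.norm_def]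
    rw [e1, mul_one] at h2
    exact h2.trans this

/-- A quadratic upper bound for the Legendre transform near a dual pair. -/
theorem exists_legendre_le (hF : Tonelli F) (B : ℝ) : ∃ D ρ, 0 ≤ D ∧ 0 < ρ ∧
    ∀ t x P v q : ℝ, |t| ≤ B → |x| ≤ B → |P| ≤ B → |v - dP F (t, x, P)| ≤ ρ →
      q * v - F (t, x, q) ≤ P * v - F (t, x, P) + D * (v - dP F (t, x, P)) ^ 2 := by
  have hK := isCompact_closedBall (0 : ℝ × ℝ × ℝ) (|B| + 1)
  have hc : Continuous fun q => fderiv ℝ (dP F) q (0, 0, 1) :=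
    (hF.contDiff_dP.continuous_fderiv one_ne_zero).clm_apply continuous_const
  obtain ⟨q₀, -, hq₀⟩ := hK.exists_isMinOn ⟨0, by simp; positivity⟩ hc.continuousOn
  set h := fderiv ℝ (dP F) q₀ (0, 0, 1) with hh
  have hpos : 0 < h := hF.pos q₀
  have hmem : ∀ t x p : ℝ, |t| ≤ B → |x| ≤ B → |p| ≤ B + 1 →
      ((t, x, p) : ℝ × ℝ × ℝ) ∈ Metric.closedBall (0 : ℝ × ℝ × ℝ) (|B| + 1) := by
    intro t x p h1 h2 h3
    have := le_abs_self B
    rw [mem_closedBall_zero_iff, Prod.norm_def, Prod.norm_def]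
    exact max_le (by simp only [Real.norm_eq_abs]; linarith)
      (max_le (by simp only [Real.norm_eq_abs]; linarith)
        (by simp only [Real.norm_eq_abs]; linarith))
  have hmono : ∀ t x a b : ℝ, |t| ≤ B → |x| ≤ B → |a| ≤ B + 1 → |b| ≤ B + 1 → a ≤ b →
      h * (b - a) ≤ dP F (t, x, b) - dP F (t, x, a) := by
    intro t x a b ht hx ha hb hab
    apply (convex_Icc a b).mul_sub_le_image_sub_of_le_deriv
      (f := fun p => dP F (t, x, p)) (C := h)
    · exact (hF.contDiff_dP.continuous.comp (by fun_prop)).continuousOn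
    · exact fun p _ => (hF.hasDerivAt_dP t x p).differentiableAt.differentiableWithinAt
    · intro p hp
      rw [(hF.hasDerivAt_dP t x p).deriv]
      rw [interior_Icc] at hp
      apply hq₀ (hmem t x p ht hx _)
      rw [abs_le] at *
      exact ⟨by linarith [hp.1], by linarith [hp.2]⟩
    · exact left_mem_Icc.2 hab
    · exact right_mem_Icc.2 hab
    · exact hab
  refine ⟨1 / h, h, by positivity, hpos, fun t x P v q ht hx hP hv => ?_⟩
  set e := v - dP F (t, x, P) with he
  have hv' : v = dP F (t, x, P) + e := by rw [he]; ring
  have hPs : |P + e / h| ≤ B + 1 := by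
    have : |e / h| ≤ 1 := by rw [abs_div, abs_of_pos hpos, div_le_one hpos]; exact hv
    exact (abs_add_le _ _).trans (by linarith)
  have hP1 : |P| ≤ B + 1 := by linarith
  have heh : e / h * h = e := by field_simp
  have hsq : e * (e / h) = 1 / h * e ^ 2 := by field_simp
  have t1 : ∀ q, q * v - F (t, x, q) ≤ P * v - F (t, x, P) + e * (q - P) := by
    intro q
    have := hF.tangent_le t x P q
    rw [hv']; linarith
  have t2 := hF.tangent_le t x (P + e / h) q
  have t3 := t1 (P + e / h)
  rw [add_sub_cancel_left, hsq] at t3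
  rcases le_total 0 e with h0 | h0
  · have hs : 0 ≤ e / h := by positivity
    have hd := hmono t x P (P + e / h) ht hx hP1 hPs (by linarith)
    rcases le_total q (P + e / h) with hq | hq
    · have := mul_le_mul_of_nonneg_left (show q - P ≤ e / h by linarith) h0
      linarith [t1 q]
    · have hd' : v ≤ dP F (t, x, P + e / h) := by rw [hv']; linarith
      have := mul_le_mul_of_nonneg_right hd' (sub_nonneg.2 hq)
      linarith
  · have hs : e / h ≤ 0 := div_nonpos_of_nonpos_of_nonneg h0 hpos.le
    have hd := hmono t x (P + e / h) P ht hx hPs hP1 (by linarith)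
    rcases le_total (P + e / h) q with hq | hq
    · have := mul_le_mul_of_nonpos_left (show e / h ≤ q - P by linarith) h0
      linarith [t1 q]
    · have hd' : dP F (t, x, P + e / h) ≤ v := by rw [hv']; linarith
      have := mul_le_mul_of_nonpos_right hd' (sub_nonpos.2 hq)
      linarith

end Tonelli

/-- Viscosity subsolutions of `∂_t w + G(t,x,∂_x w) = 0` for `t > t₀`. -/
def VSubsol (G : ℝ × ℝ → ℝ → ℝ) (t₀ : ℝ) (w : ℝ × ℝ → ℝ) : Prop :=
  ∀ φ : ℝ × ℝ → ℝ, ContDiff ℝ 1 φ → ∀ z : ℝ × ℝ, t₀ < z.1 →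
    IsLocalMax (fun y => w y - φ y) z →
    fderiv ℝ φ z (1, 0) + G z (fderiv ℝ φ z (0, 1)) ≤ 0

theorem VSubsol.neg {G : ℝ × ℝ → ℝ → ℝ} {t₀ : ℝ} {w : ℝ × ℝ → ℝ} (h : VSubsol G t₀ w) :
    VSupersol (fun z q => -G z (-q)) t₀ (fun y => -w y) := by
  intro φ hφ z hz hmin
  have e : fderiv ℝ (fun y => -φ y) z = -fderiv ℝ φ z := fderiv_fun_neg
  have := h (fun y => -φ y) hφ.neg z hz (by
    have := hmin.neg
    refine this.congr (Eventually.of_forall fun y => ?_)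
    ring)
  rw [e] at this
  simp only [neg_apply] at this
  linarith

theorem VSubsol.of_isLocalMaxOn {G : ℝ × ℝ → ℝ → ℝ} {t₀ : ℝ} {w : ℝ × ℝ → ℝ}
    (hG : Continuous fun q : (ℝ × ℝ) × ℝ => G q.1 q.2)
    (hw : ContinuousOn w {z | t₀ < z.1}) (h : VSubsol G t₀ w) {φ : ℝ × ℝ → ℝ}
    (hφ : ContDiff ℝ 1 φ) {z : ℝ × ℝ} (hz : t₀ < z.1)
    (hmax : IsLocalMaxOn (fun y => w y - φ y) {y | y.1 ≤ z.1} z) :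
    fderiv ℝ φ z (1, 0) + G z (fderiv ℝ φ z (0, 1)) ≤ 0 := by
  have e : fderiv ℝ (fun y => -φ y) z = -fderiv ℝ φ z := fderiv_fun_neg
  have hG' : Continuous fun q : (ℝ × ℝ) × ℝ => -G q.1 (-q.2) :=
    (hG.comp (continuous_fst.prodMk continuous_snd.neg)).neg
  have := h.neg.of_isLocalMinOn hG' hw.neg hφ.neg hz (by
    have := hmax.neg
    refine this.congr (Eventually.of_forall fun y => ?_) (show z.1 ≤ z.1 from le_rfl)
    simp only [Pi.neg_apply]; ring)
  rw [e] at this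
  simp only [neg_apply, neg_neg] at this
  linarith

theorem isCompact_tube {η : ℝ → ℝ} (hη : Continuous η) (a b ρ : ℝ) :
    IsCompact {y : ℝ × ℝ | y.1 ∈ Icc a b ∧ |y.2 - η y.1| ≤ ρ} := by
  have h1 : IsCompact (Icc a b ×ˢ Icc (-ρ) ρ) := isCompact_Icc.prod isCompact_Icc
  have := h1.image (f := fun y : ℝ × ℝ => (y.1, η y.1 + y.2)) (by fun_prop)
  convert this using 1
  ext y
  simp only [mem_ofPred_eq, mem_image, mem_prod, Prod.exists, abs_le]
  constructor
  · rintro ⟨h, h2⟩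
    exact ⟨y.1, y.2 - η y.1, ⟨h, h2⟩, by simp⟩
  · rintro ⟨t, z, ⟨h, h2⟩, rfl⟩
    exact ⟨h, by simpa using h2⟩

/-- Subsolutions are dominated by the action along `C¹` curves. -/
theorem VSubsol.sub_le_of_curve {F : ℝ × ℝ × ℝ → ℝ} (hF : Continuous F) {t₀ : ℝ} {w : ℝ × ℝ → ℝ}
    (hw : ContinuousOn w {z | t₀ < z.1}) (h : VSubsol (fun z q => F (z.1, z.2, q)) t₀ w)
    {η A : ℝ → ℝ} (hη : ContDiff ℝ 1 η) (hA : ContDiff ℝ 1 A) {τ t₁ : ℝ} (hτ : t₀ < τ)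
    (hle : τ ≤ t₁)
    (H : ∀ ε > 0, ∃ ρ > 0, ∀ t ∈ Icc τ t₁, ∀ x, |x - η t| ≤ ρ → ∀ q,
      q * deriv η t - F (t, x, q) ≤ deriv A t + ε) :
    w (t₁, η t₁) - w (τ, η τ) ≤ A t₁ - A τ := by
  by_contra! hneg
  set g := w (t₁, η t₁) - w (τ, η τ) - (A t₁ - A τ) with hg
  have hg0 : 0 < g := by linarith
  have hlt : τ < t₁ := by
    refine lt_of_le_of_ne hle fun e => ?_
    subst e; simp at hneg
  have hd : 0 < t₁ - τ := by linarith
  set ε := g / (2 * (t₁ - τ)) with hε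
  have hε0 : 0 < ε := by positivity
  have hεg : ε * (t₁ - τ) = g / 2 := by rw [hε]; field_simp
  obtain ⟨ρ₀, hρ₀, hρ₀'⟩ := H (ε / 2) (by positivity)
  have hopen : ∀ z : ℝ × ℝ, t₀ < z.1 → ContinuousAt w z := fun z hz =>
    hw.continuousAt ((isOpen_lt continuous_const continuous_fst).mem_nhds hz)
  have hc : ContinuousAt (fun x => w (τ, x)) (η τ) :=
    ContinuousAt.comp (g := w) (hopen (τ, η τ) hτ) (by fun_prop)
  obtain ⟨ρ₁, hρ₁, hρ₁'⟩ := Metric.nhds_basis_closedBall.eventually_iff.1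
    (hc.eventually_lt_const (show w (τ, η τ) < w (τ, η τ) + g / 4 by linarith))
  set ρ := min ρ₀ ρ₁ with hρ
  have hρ0 : 0 < ρ := lt_min hρ₀ hρ₁
  set K := {y : ℝ × ℝ | y.1 ∈ Icc τ t₁ ∧ |y.2 - η y.1| ≤ ρ} with hK
  have hKc : IsCompact K := isCompact_tube hη.continuous _ _ _
  have hwK : ContinuousOn w K := hw.mono fun y hy => lt_of_lt_of_le hτ hy.1.1
  have hηc := hη.continuous
  have hAc := hA.continuous
  obtain ⟨M, hM⟩ := hKc.exists_bound_of_continuousOn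
    (f := fun y => w y - A y.1 - ε * y.1) (by fun_prop)
  obtain ⟨N, hN⟩ := exists_nat_gt (2 * M / ρ ^ 2)
  rw [div_lt_iff₀ (by positivity)] at hN
  set φ : ℝ × ℝ → ℝ := fun y => N * (y.2 - η y.1) ^ 2 + A y.1 + ε * y.1 with hφ
  have hφc : ContDiff ℝ 1 φ := by
    simp only [hφ]
    have h1 : ContDiff ℝ 1 fun y : ℝ × ℝ => η y.1 := hη.comp contDiff_fst
    have h2 : ContDiff ℝ 1 fun y : ℝ × ℝ => A y.1 := hA.comp contDiff_fst
    fun_prop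
  have hmem : (t₁, η t₁) ∈ K := ⟨⟨hle, le_rfl⟩, by simpa using hρ0.le⟩
  obtain ⟨y, hyK, hy⟩ := hKc.exists_isMaxOn ⟨_, hmem⟩
    (f := fun y => w y - φ y) (hwK.sub hφc.continuous.continuousOn)
  have hy1 : w (t₁, η t₁) - A t₁ - ε * t₁ ≤ w y - φ y := by
    have := hy hmem
    simp only [mem_ofPred_eq, hφ] at this ⊢
    simp at this; linarith
  have hyτ : τ < y.1 := by
    refine lt_of_le_of_ne hyK.1.1 fun e => ?_
    have h2 : w y < w (τ, η τ) + g / 4 := by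
      have : w (τ, y.2) < _ := @hρ₁' y.2 (by
        rw [Metric.mem_closedBall, Real.dist_eq, e]
        exact hyK.2.trans (min_le_right _ _))
      rwa [e] at this ⊢
    have h3 : 0 ≤ N * (y.2 - η y.1) ^ 2 := by positivity
    simp only [hφ, ← e] at hy1 h3
    nlinarith
  have hyρ : |y.2 - η y.1| < ρ := by
    refine lt_of_le_of_ne hyK.2 fun e => ?_
    have h1 := hM y hyK
    have h2 := hM _ hmem
    rw [Real.norm_eq_abs, abs_le] at h1 h2
    have h3 : (y.2 - η y.1) ^ 2 = ρ ^ 2 := by rw [← e, sq_abs]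
    simp only [hφ, h3] at hy1 h1 h2
    linarith
  have hloc : IsLocalMaxOn (fun y => w y - φ y) {x | x.1 ≤ y.1} y := by
    rw [IsLocalMaxOn, IsMaxFilter, eventually_nhdsWithin_iff]
    have e1 : ∀ᶠ x : ℝ × ℝ in 𝓝 y, τ < x.1 :=
      continuous_fst.continuousAt.eventually_const_lt hyτ
    have e2 : ∀ᶠ x : ℝ × ℝ in 𝓝 y, |x.2 - η x.1| < ρ :=
      (show ContinuousAt (fun x : ℝ × ℝ => |x.2 - η x.1|) y by fun_prop).eventually_lt_const hyρ
    filter_upwards [e1, e2] with x h1 h2 h3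
    exact hy ⟨⟨h1.le, h3.trans hyK.1.2⟩, h2.le⟩
  have key := h.of_isLocalMaxOn (hF.comp (by fun_prop)) hw hφc (hτ.trans hyτ) hloc
  have hφd := hφc.differentiable one_ne_zero y
  have hηd := (hη.differentiable one_ne_zero y.1).hasDerivAt
  have hAd := (hA.differentiable one_ne_zero y.1).hasDerivAt
  have d1 : fderiv ℝ φ y (1, 0) =
      -(2 * N * (y.2 - η y.1)) * deriv η y.1 + deriv A y.1 + ε := by
    apply fderiv_apply_fst_of_hasDerivAt hφd
    have := (((hηd.const_sub y.2).pow 2).const_mul (N : ℝ)).add hAd |>.add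
      ((hasDerivAt_id y.1).const_mul ε)
    refine HasDerivAt.congr_deriv (f := fun _ => _) this ?_
    simp; ring
  have d2 : fderiv ℝ φ y (0, 1) = 2 * N * (y.2 - η y.1) := by
    apply fderiv_apply_snd_of_hasDerivAt hφd
    have := (((((hasDerivAt_id y.2).sub_const (η y.1)).pow 2).const_mul (N : ℝ)).add_const
      (A y.1)).add_const (ε * y.1)
    refine HasDerivAt.congr_deriv (f := fun _ => _) this ?_
    simp; ring
  rw [d1, d2] at key
  have := hρ₀' y.1 hyK.1 y.2 (hyK.2.trans (min_le_left _ _)) (2 * N * (y.2 - η y.1))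
  linarith

theorem contDiff_one_of_hasDerivAt {f g : ℝ → ℝ} (h : ∀ t, HasDerivAt f (g t) t)
    (hg : Continuous g) : ContDiff ℝ 1 f := by
  rw [contDiff_one_iff_deriv]
  refine ⟨fun t => (h t).differentiableAt, ?_⟩
  rwa [show deriv f = g from funext fun t => (h t).deriv]

namespace IsOrbit

variable {F : ℝ × ℝ × ℝ → ℝ} {γ : ℝ → ℝ × ℝ}

theorem continuous (h : IsOrbit F γ) : Continuous γ :=
  continuous_iff_continuousAt.2 fun t => (h t).continuousAt

theorem hasDerivAt_fst (h : IsOrbit F γ) (t : ℝ) :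
    HasDerivAt (fun t => (γ t).1) (dP F (t, γ t)) t :=
  (hasFDerivAt_fst (𝕜 := ℝ) (p := γ t)).comp_hasDerivAt t (h t)

theorem hasDerivAt_snd (h : IsOrbit F γ) (t : ℝ) :
    HasDerivAt (fun t => (γ t).2) (-dX F (t, γ t)) t :=
  (hasFDerivAt_snd (𝕜 := ℝ) (p := γ t)).comp_hasDerivAt t (h t)

theorem contDiff_fst (h : IsOrbit F γ) (hF : Tonelli F) : ContDiff ℝ 1 fun t => (γ t).1 := by
  have := h.continuous
  have := hF.contDiff_dP.continuous
  exact contDiff_one_of_hasDerivAt h.hasDerivAt_fst (by fun_prop)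

theorem contDiff_snd (h : IsOrbit F γ) (hF : Tonelli F) : ContDiff ℝ 1 fun t => (γ t).2 := by
  have := h.continuous
  have := hF.contDiff_dX.continuous
  exact contDiff_one_of_hasDerivAt h.hasDerivAt_snd (by fun_prop)

end IsOrbit

/-- `a` is a primitive of the Lagrangian along the orbit `γ`. -/
def IsAction (F : ℝ × ℝ × ℝ → ℝ) (γ : ℝ → ℝ × ℝ) (a : ℝ → ℝ) : Prop :=
  ∀ t, HasDerivAt a ((γ t).2 * dP F (t, γ t) - F (t, γ t)) t

section

variable {F : ℝ × ℝ × ℝ → ℝ} {γ : ℝ → ℝ × ℝ} {a : ℝ → ℝ}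

theorem IsOrbit.continuous_lagrangian (h : IsOrbit F γ) (hF : Tonelli F) :
    Continuous fun t => (γ t).2 * dP F (t, γ t) - F (t, γ t) := by
  have := h.continuous
  have := hF.contDiff_dP.continuous
  have := hF.continuous
  fun_prop

theorem IsOrbit.exists_isAction (h : IsOrbit F γ) (hF : Tonelli F) (t₁ c : ℝ) :
    ∃ a, IsAction F γ a ∧ a t₁ = c := by
  have hc := h.continuous_lagrangian hF
  refine ⟨fun t => c + ∫ s in t₁..t, ((γ s).2 * dP F (s, γ s) - F (s, γ s)), fun t => ?_, by simp⟩
  exact (intervalIntegral.integral_hasDerivAt_right (hc.intervalIntegrable _ _)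
    (hc.stronglyMeasurableAtFilter _ _) hc.continuousAt).const_add c

theorem IsAction.contDiff (ha : IsAction F γ a) (h : IsOrbit F γ) (hF : Tonelli F) :
    ContDiff ℝ 1 a :=
  contDiff_one_of_hasDerivAt ha (h.continuous_lagrangian hF)

theorem IsOrbit.exists_bound (h : IsOrbit F γ) (s t₁ : ℝ) : ∃ B, 0 ≤ B ∧ ∀ t ∈ Icc s t₁,
    |t| ≤ B ∧ |(γ t).1| ≤ B ∧ |(γ t).2| ≤ B := by
  have hγ := h.continuous
  obtain ⟨B, hB⟩ := (isCompact_Icc (a := s) (b := t₁)).exists_bound_of_continuousOn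
    (f := fun t => (t, γ t)) (by fun_prop)
  refine ⟨|B|, abs_nonneg B, fun t ht => ?_⟩
  have := (hB t ht).trans (le_abs_self B)
  rw [Prod.norm_def, Prod.norm_def, max_le_iff, max_le_iff] at this
  exact this

theorem VSubsol.exists_lower_bound (hF : Tonelli F) {t₀ : ℝ} {w : ℝ × ℝ → ℝ}
    (hw : ContinuousOn w {z | t₀ < z.1}) (hsub : VSubsol (fun z q => F (z.1, z.2, q)) t₀ w)
    (h : IsOrbit F γ) (ha : IsAction F γ a) {s t₁ r₀ : ℝ} (hs : t₀ < s) (hst : s ≤ t₁)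
    (hr₀ : 0 < r₀)
    (htouch : ∀ z, |z| ≤ r₀ → a t₁ + (γ t₁).2 * z ≤ w (t₁, (γ t₁).1 + z)) :
    ∃ C r, 0 ≤ C ∧ 0 < r ∧ ∀ τ ∈ Icc s t₁, ∀ z, |z| ≤ r →
      a τ + (γ τ).2 * z - C * z ^ 2 ≤ w (τ, (γ τ).1 + z) := by
  obtain ⟨B, hB0, hB⟩ := h.exists_bound s t₁
  obtain ⟨C, hC0, hC⟩ := hF.exists_taylor_xp (B + 1)
  obtain ⟨D, ρ, hD0, hρ, hD⟩ := hF.exists_legendre_le (B + 1)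
  obtain ⟨L, hL⟩ := (isCompact_Icc (a := s) (b := t₁)).exists_bound_of_continuousOn
    (f := fun t => dX F (t, γ t)) (by
      have := h.continuous
      have := hF.contDiff_dX.continuous
      fun_prop)
  set E := C + D * C ^ 2 with hE
  have hE0 : 0 ≤ E := by positivity
  set r := min r₀ (min (1 / 2) (ρ / (2 * (C + 1)))) with hr
  have hr0 : 0 < r := by positivity
  refine ⟨E * (t₁ - s), r, mul_nonneg hE0 (by linarith), hr0, fun τ hτ z hz => ?_⟩
  have hz0 : |z| ≤ r₀ := hz.trans (min_le_left _ _)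
  have hz1 : |z| ≤ 1 / 2 := hz.trans ((min_le_right _ _).trans (min_le_left _ _))
  have hz2 : |z| ≤ ρ / (2 * (C + 1)) := hz.trans ((min_le_right _ _).trans (min_le_right _ _))
  have hη : ContDiff ℝ 1 fun t => (γ t).1 + z := (h.contDiff_fst hF).add contDiff_const
  have hA : ContDiff ℝ 1 fun t => a t + (γ t).2 * z + E * z ^ 2 * t :=
    ((ha.contDiff h hF).add ((h.contDiff_snd hF).mul contDiff_const)).add
      (contDiff_const.mul contDiff_id)
  have key := hsub.sub_le_of_curve hF.continuous hw hη hA (hs.trans_le hτ.1) hτ.2 (by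
    intro ε hε
    have hden : 0 < 2 * (C + 1) := by positivity
    have hL1 : 0 < |L| + 3 * E + 1 := by positivity
    refine ⟨min (min (1 / 2) (ρ / (2 * (C + 1)))) (ε / (|L| + 3 * E + 1)), by positivity,
      fun t ht x hx q => ?_⟩
    obtain ⟨hBt, hBx, hBp⟩ := hB t ⟨hτ.1.trans ht.1, ht.2⟩
    have hLt := (hL t ⟨hτ.1.trans ht.1, ht.2⟩).trans (le_abs_self L)
    have e1 : deriv (fun t => (γ t).1 + z) t = dP F (t, γ t) :=
      ((h.hasDerivAt_fst t).add_const z).deriv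
    have e2 : deriv (fun t => a t + (γ t).2 * z + E * z ^ 2 * t) t =
        (γ t).2 * dP F (t, γ t) - F (t, γ t) + -dX F (t, γ t) * z + E * z ^ 2 := by
      have := ((ha t).add ((h.hasDerivAt_snd t).mul_const z)).add
        ((hasDerivAt_id t).const_mul (E * z ^ 2))
      rw [mul_one] at this
      exact this.deriv
    rw [e1, e2]
    set d := x - ((γ t).1 + z) with hd
    have hd1 : |d| ≤ 1 / 2 := hx.trans ((min_le_left _ _).trans (min_le_left _ _))
    have hd2 : |d| ≤ ρ / (2 * (C + 1)) := hx.trans ((min_le_left _ _).trans (min_le_right _ _))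
    have hd3 : |d| ≤ ε / (|L| + 3 * E + 1) := hx.trans (min_le_right _ _)
    rw [le_div_iff₀ (by positivity)] at hd3
    have hx' : x = (γ t).1 + (z + d) := by rw [hd]; ring
    have hzd : |z + d| ≤ |z| + |d| := abs_add_le _ _
    have hxB : |(γ t).1 + (z + d)| ≤ B + 1 := (abs_add_le _ _).trans (by linarith)
    have hT := hC t (γ t).1 (γ t).2 (z + d) 0 (by linarith) (by linarith) (by linarith) hxB
      (by rw [add_zero]; linarith)
    rw [add_zero, mul_zero, sub_zero] at hT
    have hbd : |dP F (t, γ t) - dP F (t, (γ t).1 + (z + d), (γ t).2)| ≤ C * |z + d| := by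
      rw [abs_sub_comm]; exact hT.2
    have hsmall : C * |z + d| ≤ ρ := by
      have : C * |z + d| ≤ (C + 1) * (ρ / (2 * (C + 1)) + ρ / (2 * (C + 1))) := by
        gcongr <;> linarith
      refine this.trans (le_of_eq ?_)
      field_simp; ring
    have hLeg := hD t ((γ t).1 + (z + d)) (γ t).2 (dP F (t, γ t)) q (by linarith) hxB
      (by linarith) (hbd.trans hsmall)
    have hsq : (dP F (t, γ t) - dP F (t, (γ t).1 + (z + d), (γ t).2)) ^ 2 ≤
        C ^ 2 * (z + d) ^ 2 := by
      rw [← sq_abs, ← sq_abs (z + d), ← mul_pow]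
      gcongr
    have hsq' := mul_le_mul_of_nonneg_left hsq hD0
    have hzd2 : (z + d) ^ 2 ≤ z ^ 2 + 3 * |d| := by
      have h1 : z * d ≤ 1 / 2 * |d| := by
        refine (le_abs_self _).trans ?_
        rw [abs_mul]; gcongr
      have h2 : d ^ 2 ≤ 1 / 2 * |d| := by
        rw [← sq_abs, sq]; gcongr
      have h3 : 0 ≤ |d| := abs_nonneg d
      linarith [add_sq z d]
    have hEE := mul_le_mul_of_nonneg_left hzd2 hE0
    have hX : -(dX F (t, γ t) * d) ≤ |L| * |d| := by
      refine (neg_le_abs _).trans ?_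
      rw [abs_mul]
      exact mul_le_mul_of_nonneg_right hLt (abs_nonneg d)
    have hT1 := (abs_le.1 hT.1).1
    have e3 : F (t, (γ t).1, (γ t).2) = F (t, γ t) := rfl
    have e4 : dX F (t, (γ t).1, (γ t).2) = dX F (t, γ t) := rfl
    rw [e3, e4] at hT1
    have h3 : 0 ≤ |d| := abs_nonneg d
    rw [hx']
    have h0 : (0 : ℝ) ^ 2 = 0 := by norm_num
    rw [h0] at hT1
    have hEexp : E * (z + d) ^ 2 = C * (z + d) ^ 2 + D * (C ^ 2 * (z + d) ^ 2) := by rw [hE]; ring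
    linarith)
  have hτ1 : 0 ≤ E * z ^ 2 * (τ - s) :=
    mul_nonneg (mul_nonneg hE0 (sq_nonneg _)) (by linarith [hτ.1])
  have := htouch z hz0
  beta_reduce at key
  linarith

/-- Backward propagation of the calibration identity over a short time. -/
theorem VSupersol.exists_le_action (hF : Tonelli F) {t₀ : ℝ} {w : ℝ × ℝ → ℝ}
    (hw : ContinuousOn w {z | t₀ < z.1}) (hsup : VSupersol (fun z q => F (z.1, z.2, q)) t₀ w)
    (h : IsOrbit F γ) (ha : IsAction F γ a) {s t₁ C₁ r₁ : ℝ} (hs : t₀ < s)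
    (hC₁ : 0 ≤ C₁) (hr₁ : 0 < r₁)
    (hlow : ∀ τ ∈ Icc s t₁, ∀ z, |z| ≤ r₁ →
      a τ + (γ τ).2 * z - C₁ * z ^ 2 ≤ w (τ, (γ τ).1 + z)) :
    ∃ δ > 0, ∀ t₂ ∈ Icc s t₁, w (t₂, (γ t₂).1) ≤ a t₂ →
      ∀ τ ∈ Icc s t₂, t₂ - τ ≤ δ → w (τ, (γ τ).1) ≤ a τ := by
  obtain ⟨B, hB0, hB⟩ := h.exists_bound s t₁
  obtain ⟨C, hC0, hC⟩ := hF.exists_taylor_xp (B + 1)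
  set k₁ := C₁ + 1 with hk₁
  have hk₁0 : 0 < k₁ := by positivity
  set g := C * (1 + 4 * k₁ ^ 2) + 1 with hg
  have hg0 : 0 < g := by positivity
  set r := min r₁ (min 1 (1 / (2 * k₁))) with hr
  have hr0 : 0 < r := by positivity
  have hrr : r ≤ r₁ := min_le_left _ _
  have hr1 : r ≤ 1 := (min_le_right _ _).trans (min_le_left _ _)
  have hrk : r ≤ 1 / (2 * k₁) := (min_le_right _ _).trans (min_le_right _ _)
  rw [le_div_iff₀ (by positivity)] at hrk
  refine ⟨1 / (2 * g), by positivity, fun t₂ ht₂ hw₂ τ hτ hδ => ?_⟩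
  rw [le_div_iff₀ (by positivity)] at hδ
  by_contra! hneg
  have hlt : τ < t₂ := by
    refine lt_of_le_of_ne hτ.2 fun e => ?_
    subst e; linarith
  have hξ := h.contDiff_fst hF
  have hp := h.contDiff_snd hF
  have haC := ha.contDiff h hF
  set k : ℝ → ℝ := fun t => k₁ - g * (t₂ - t) with hk
  have hkI : ∀ t ∈ Icc τ t₂, C₁ + 1 / 2 ≤ k t ∧ k t ≤ k₁ := by
    intro t ht
    simp only [hk, hk₁]
    have h1 : g * (t₂ - t) ≤ g * (t₂ - τ) := by
      apply mul_le_mul_of_nonneg_left _ hg0.le; linarith [ht.1]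
    have h2 : 0 ≤ g * (t₂ - t) := mul_nonneg hg0.le (by linarith [ht.2])
    constructor <;> linarith
  set S : ℝ × ℝ → ℝ := fun y =>
    a y.1 + (γ y.1).2 * (y.2 - (γ y.1).1) - k y.1 * (y.2 - (γ y.1).1) ^ 2 with hS
  have hSC : ContDiff ℝ 1 S := by
    have h1 : ContDiff ℝ 1 fun y : ℝ × ℝ => (γ y.1).1 := hξ.comp _root_.contDiff_fst
    have h2 : ContDiff ℝ 1 fun y : ℝ × ℝ => (γ y.1).2 := hp.comp _root_.contDiff_fst
    have h3 : ContDiff ℝ 1 fun y : ℝ × ℝ => a y.1 := haC.comp _root_.contDiff_fst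
    simp only [hS, hk]
    fun_prop
  have hSc := hSC.continuous
  have hgap : ∀ t ∈ Icc τ t₂, ∀ x, |x - (γ t).1| ≤ r →
      (x - (γ t).1) ^ 2 / 2 ≤ w (t, x) - S (t, x) := by
    intro t ht x hx
    have := hlow t ⟨hτ.1.trans ht.1, ht.2.trans ht₂.2⟩ _ (hx.trans hrr)
    rw [add_sub_cancel] at this
    have h1 := mul_le_mul_of_nonneg_right (hkI t ht).1 (sq_nonneg (x - (γ t).1))
    simp only [hS]
    linarith
  -- positivity of the gap at the initial time
  have hslice : ContinuousOn (fun x => w (τ, x) - S (τ, x)) (Icc ((γ τ).1 - r) ((γ τ).1 + r)) := by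
    apply ContinuousOn.sub
    · exact hw.comp (by fun_prop) fun x _ => hs.trans_le hτ.1
    · fun_prop
  obtain ⟨x₀, hx₀, hx₀m⟩ := isCompact_Icc.exists_isMinOn
    ⟨(γ τ).1, by constructor <;> linarith⟩ hslice
  set m := w (τ, x₀) - S (τ, x₀) with hm
  have hm0 : 0 < m := by
    by_cases hx : x₀ = (γ τ).1
    · rw [hm, hx]; simp only [hS, sub_self]; norm_num; linarith
    · have := hgap τ ⟨le_rfl, hlt.le⟩ x₀ (by rw [abs_le]; constructor <;> linarith [hx₀.1, hx₀.2])
      have h2 : 0 < (x₀ - (γ τ).1) ^ 2 := by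
        have := sub_ne_zero.2 hx
        positivity
      linarith
  set ε := min m (r ^ 2 / 2) / (2 * (t₂ - τ)) with hε
  have hd : 0 < t₂ - τ := by linarith
  have hε0 : 0 < ε := by positivity
  have hεe : ε * (t₂ - τ) = min m (r ^ 2 / 2) / 2 := by rw [hε]; field_simp
  have hmin0 : 0 < min m (r ^ 2 / 2) := by positivity
  have hεm : ε * (t₂ - τ) < m := by linarith [min_le_left m (r ^ 2 / 2)]
  have hεr : ε * (t₂ - τ) < r ^ 2 / 2 := by linarith [min_le_right m (r ^ 2 / 2)]
  set φ : ℝ × ℝ → ℝ := fun y => S y + ε * (t₂ - y.1) with hφ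
  have hφC : ContDiff ℝ 1 φ := by simp only [hφ]; fun_prop
  set K := {y : ℝ × ℝ | y.1 ∈ Icc τ t₂ ∧ |y.2 - (γ y.1).1| ≤ r} with hK
  have hKc : IsCompact K := isCompact_tube hξ.continuous _ _ _
  have hmem : (t₂, (γ t₂).1) ∈ K := ⟨⟨hlt.le, le_rfl⟩, by simpa using hr0.le⟩
  obtain ⟨y, hyK, hy⟩ := hKc.exists_isMinOn ⟨_, hmem⟩ (f := fun y => w y - φ y)
    ((hw.mono fun y hy => hs.trans_le (hτ.1.trans hy.1.1)).sub hφC.continuous.continuousOn)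
  have hval : w y - φ y ≤ 0 := by
    refine (hy hmem).trans ?_
    simp only [hφ, hS, sub_self]; norm_num; linarith
  simp only [hφ] at hval
  have hyε : ε * (t₂ - y.1) ≤ ε * (t₂ - τ) := by
    apply mul_le_mul_of_nonneg_left _ hε0.le; linarith [hyK.1.1]
  have hyτ : τ < y.1 := by
    refine lt_of_le_of_ne hyK.1.1 fun e => ?_
    have h2 := hyK.2
    rw [← e, abs_le] at h2
    have : m ≤ w (τ, y.2) - S (τ, y.2) := hx₀m
      (show y.2 ∈ Icc ((γ τ).1 - r) ((γ τ).1 + r) from ⟨by linarith [h2.1], by linarith [h2.2]⟩)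
    have e' : (τ, y.2) = y := Prod.ext e rfl
    rw [e'] at this
    linarith
  have hyr : |y.2 - (γ y.1).1| < r := by
    refine lt_of_le_of_ne hyK.2 fun e => ?_
    have := hgap y.1 hyK.1 y.2 hyK.2
    rw [← sq_abs, e] at this
    linarith
  have hloc : IsLocalMinOn (fun y => w y - φ y) {x | x.1 ≤ y.1} y := by
    rw [IsLocalMinOn, IsMinFilter, eventually_nhdsWithin_iff]
    have e1 : ∀ᶠ x : ℝ × ℝ in 𝓝 y, τ < x.1 :=
      continuous_fst.continuousAt.eventually_const_lt hyτ
    have hγc := h.continuous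
    have e2 : ∀ᶠ x : ℝ × ℝ in 𝓝 y, |x.2 - (γ x.1).1| < r :=
      (show ContinuousAt (fun x : ℝ × ℝ => |x.2 - (γ x.1).1|) y by
        fun_prop).eventually_lt_const hyr
    filter_upwards [e1, e2] with x h1 h2 h3
    exact hy ⟨⟨h1.le, h3.trans hyK.1.2⟩, h2.le⟩
  have key := hsup.of_isLocalMinOn (hF.continuous.comp (by fun_prop)) hw hφC
    (hs.trans_le (hτ.1.trans hyτ.le)) hloc
  have hφd := hφC.differentiable one_ne_zero y
  set z := y.2 - (γ y.1).1 with hz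
  have d1 : fderiv ℝ φ y (1, 0) = -F (y.1, γ y.1) - dX F (y.1, γ y.1) * z
      + 2 * k y.1 * z * dP F (y.1, γ y.1) - g * z ^ 2 - ε := by
    apply fderiv_apply_fst_of_hasDerivAt hφd
    have hz' := (h.hasDerivAt_fst y.1).const_sub y.2
    have hk' : HasDerivAt k g y.1 := by
      have := (((hasDerivAt_id y.1).const_sub t₂).const_mul g).const_sub k₁
      refine HasDerivAt.congr_deriv (f := fun _ => _) this ?_
      ring
    have := (((ha y.1).add ((h.hasDerivAt_snd y.1).mul hz')).sub (hk'.mul (hz'.pow 2))).add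
      (((hasDerivAt_id y.1).const_sub t₂).const_mul ε)
    refine HasDerivAt.congr_deriv (f := fun _ => _) this ?_
    simp [← hz]; ring
  have d2 : fderiv ℝ φ y (0, 1) = (γ y.1).2 + -(2 * k y.1 * z) := by
    apply fderiv_apply_snd_of_hasDerivAt hφd
    have hz' := (hasDerivAt_id y.2).sub_const (γ y.1).1
    have := (((hz'.const_mul (γ y.1).2).const_add (a y.1)).sub ((hz'.pow 2).const_mul
      (k y.1))).add_const (ε * (t₂ - y.1))
    refine HasDerivAt.congr_deriv (f := fun _ => _) this ?_
    simp [← hz]; ring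
  rw [d1, d2] at key
  obtain ⟨hBt, hBx, hBp⟩ := hB y.1 ⟨hτ.1.trans hyτ.le, hyK.1.2.trans ht₂.2⟩
  obtain ⟨hk0, hk1⟩ := hkI y.1 hyK.1
  have hkz : |-(2 * k y.1 * z)| ≤ 1 := by
    rw [abs_neg, abs_mul, abs_of_nonneg (by linarith)]
    calc 2 * k y.1 * |z| ≤ 2 * k₁ * r := by gcongr
      _ ≤ 1 := by linarith
  have hyz : y.2 = (γ y.1).1 + z := by rw [hz]; ring
  have hT := (abs_le.1 (hC y.1 (γ y.1).1 (γ y.1).2 z (-(2 * k y.1 * z)) (by linarith)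
    (by linarith) (by linarith) ((abs_add_le _ _).trans (by linarith))
    ((abs_add_le _ _).trans (by linarith))).1).2
  have hk2 : (-(2 * k y.1 * z)) ^ 2 ≤ 4 * k₁ ^ 2 * z ^ 2 := by
    have : k y.1 ^ 2 ≤ k₁ ^ 2 := by gcongr; linarith
    have := mul_le_mul_of_nonneg_right this (sq_nonneg z)
    linarith
  have hk3 := mul_le_mul_of_nonneg_left hk2 hC0
  rw [← hyz] at hT
  have hgz : g * z ^ 2 = C * z ^ 2 + C * (4 * k₁ ^ 2 * z ^ 2) + z ^ 2 := by rw [hg]; ring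
  have hz0 := sq_nonneg z
  have e3 : F (y.1, (γ y.1).1, (γ y.1).2) = F (y.1, γ y.1) := rfl
  have e4 : dX F (y.1, (γ y.1).1, (γ y.1).2) = dX F (y.1, γ y.1) := rfl
  have e5 : dP F (y.1, (γ y.1).1, (γ y.1).2) = dP F (y.1, γ y.1) := rfl
  rw [e3, e4, e5] at hT
  linarith

/-- A solution touched from below at `t₁` by an affine function is calibrated along the backward
orbit issued from the touching point. -/
theorem eq_action_of_touching (hF : Tonelli F) {t₀ : ℝ} {w : ℝ × ℝ → ℝ}
    (hw : ContinuousOn w {z | t₀ < z.1}) (hsub : VSubsol (fun z q => F (z.1, z.2, q)) t₀ w)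
    (hsup : VSupersol (fun z q => F (z.1, z.2, q)) t₀ w)
    (h : IsOrbit F γ) (ha : IsAction F γ a) {s t₁ r₀ : ℝ} (hs : t₀ < s) (hst : s ≤ t₁)
    (hr₀ : 0 < r₀) (hat : a t₁ = w (t₁, (γ t₁).1))
    (htouch : ∀ z, |z| ≤ r₀ →
      w (t₁, (γ t₁).1) + (γ t₁).2 * z ≤ w (t₁, (γ t₁).1 + z)) :
    w (s, (γ s).1) ≤ a s := by
  rw [← hat] at htouch
  obtain ⟨C, r, hC, hr, hlow⟩ := hsub.exists_lower_bound hF hw h ha hs hst hr₀ htouch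
  obtain ⟨δ, hδ, hstep⟩ := hsup.exists_le_action hF hw h ha hs hC hr hlow
  have key : ∀ n : ℕ, ∀ τ ∈ Icc s t₁, t₁ - τ ≤ n * δ → w (τ, (γ τ).1) ≤ a τ := by
    intro n
    induction n with
    | zero =>
      intro τ hτ h0
      have : τ = t₁ := le_antisymm hτ.2 (by simpa using h0)
      rw [this, hat]
    | succ n ih =>
      intro τ hτ h1
      push_cast at h1
      have hmem : min (τ + δ) t₁ ∈ Icc s t₁ :=
        ⟨le_min (by linarith [hτ.1]) hst, min_le_right _ _⟩
      refine hstep _ hmem (ih _ hmem ?_) τ ⟨hτ.1, le_min (by linarith) hτ.2⟩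
        (by linarith [min_le_left (τ + δ) t₁])
      rcases min_cases (τ + δ) t₁ with h2 | h2 <;> rw [h2.1]
      · linarith
      · rw [sub_self]; positivity
  obtain ⟨n, hn⟩ := exists_nat_ge ((t₁ - s) / δ)
  exact key n s ⟨le_rfl, hst⟩ (by rwa [div_le_iff₀ hδ] at hn)

end

namespace Tonelli

variable {F : ℝ × ℝ × ℝ → ℝ}

theorem add_int (hF : Tonelli F) (n m : ℤ) (q : ℝ × ℝ × ℝ) :
    F (q + ((n : ℝ), (m : ℝ), (0 : ℝ))) = F q := by
  obtain ⟨t, x, p⟩ := q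
  have h1 : Function.Periodic (fun t => F (t, x + m, p)) 1 := fun t => hF.per_t t _ p
  have h2 : Function.Periodic (fun x => F (t, x, p)) 1 := fun x => hF.per_x t x p
  have h3 := h1.int_mul n t
  have h4 := h2.int_mul m x
  simp only [mul_one] at h3 h4
  simp only [Prod.mk_add_mk, add_zero]
  rw [h3, h4]

theorem fderiv_add_int (hF : Tonelli F) (n m : ℤ) (q : ℝ × ℝ × ℝ) :
    fderiv ℝ F (q + ((n : ℝ), (m : ℝ), (0 : ℝ))) = fderiv ℝ F q := by
  have := fderiv_comp_add_right (𝕜 := ℝ) (f := F) (x := q) ((n : ℝ), (m : ℝ), (0 : ℝ))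
  rw [← this]
  congr 1
  exact funext fun q => hF.add_int n m q

theorem dP_add_int (hF : Tonelli F) (n m : ℤ) (t x p : ℝ) :
    dP F (t + n, x + m, p) = dP F (t, x, p) := by
  have := hF.fderiv_add_int n m (t, x, p)
  simp only [Prod.mk_add_mk, add_zero] at this
  rw [dP, this, dP]

theorem dX_add_int (hF : Tonelli F) (n m : ℤ) (t x p : ℝ) :
    dX F (t + n, x + m, p) = dX F (t, x, p) := by
  have := hF.fderiv_add_int n m (t, x, p)
  simp only [Prod.mk_add_mk, add_zero] at this
  rw [dX, this, dX]

theorem exists_lt_dP (hF : Tonelli F) (A t x : ℝ) :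
    ∃ R > 0, A < dP F (t, x, R) ∧ dP F (t, x, -R) < -A := by
  have h := (hF.superlinear t x).eventually_ge_atTop (A + 1 + |F (t, x, 0)|)
  have h1 := h.filter_mono IsOrderBornology.atTop_le_cobounded
  have h2 := tendsto_neg_atTop_atBot.eventually
    (h.filter_mono IsOrderBornology.atBot_le_cobounded)
  obtain ⟨R, hR1, hR2, hR⟩ := (h1.and (h2.and (eventually_ge_atTop 1))).exists
  have hR0 : 0 < R := by linarith
  rw [abs_neg] at hR2
  rw [abs_of_pos hR0, le_div_iff₀ hR0] at hR1 hR2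
  have hle := le_abs_self (F (t, x, 0))
  have hR3 : |F (t, x, 0)| ≤ |F (t, x, 0)| * R := le_mul_of_one_le_right (abs_nonneg _) hR
  have e1 := hF.tangent_le t x R 0
  have e2 := hF.tangent_le t x (-R) 0
  refine ⟨R, hR0, ?_, ?_⟩
  · apply lt_of_mul_lt_mul_right _ hR0.le
    linarith
  · apply lt_of_mul_lt_mul_right _ hR0.le
    linarith

/-- Uniform properness of the speed. -/
theorem exists_forall_le_dP (hF : Tonelli F) (A : ℝ) : ∃ R > 0, ∀ t x p,
    (R ≤ p → A ≤ dP F (t, x, p)) ∧ (p ≤ -R → dP F (t, x, p) ≤ -A) := by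
  have key : ∃ R > 0, ∀ z ∈ Icc (0 : ℝ) 1 ×ˢ Icc (0 : ℝ) 1, ∀ p,
      (R ≤ p → A ≤ dP F (z.1, z.2, p)) ∧ (p ≤ -R → dP F (z.1, z.2, p) ≤ -A) := by
    apply (isCompact_Icc.prod isCompact_Icc).induction_on
      (p := fun s : Set (ℝ × ℝ) => ∃ R > 0, ∀ z ∈ s, ∀ p,
      (R ≤ p → A ≤ dP F (z.1, z.2, p)) ∧ (p ≤ -R → dP F (z.1, z.2, p) ≤ -A))
    · exact ⟨1, one_pos, by simp⟩
    · rintro s t hst ⟨R, hR, h⟩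
      exact ⟨R, hR, fun z hz => h z (hst hz)⟩
    · rintro s t ⟨R, hR, h⟩ ⟨R', hR', h'⟩
      refine ⟨max R R', lt_max_of_lt_left hR, fun z hz p => ?_⟩
      have l1 := le_max_left R R'
      have l2 := le_max_right R R'
      rcases hz with hz | hz
      · exact ⟨fun hp => (h z hz p).1 (by linarith), fun hp => (h z hz p).2 (by linarith)⟩
      · exact ⟨fun hp => (h' z hz p).1 (by linarith), fun hp => (h' z hz p).2 (by linarith)⟩
    · rintro ⟨t, x⟩ -
      obtain ⟨R, hR, h1, h2⟩ := hF.exists_lt_dP A t x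
      have hc := hF.contDiff_dP.continuous
      have c1 : ContinuousAt (fun z : ℝ × ℝ => dP F (z.1, z.2, R)) (t, x) := by fun_prop
      have c2 : ContinuousAt (fun z : ℝ × ℝ => dP F (z.1, z.2, -R)) (t, x) := by fun_prop
      refine ⟨{z | A < dP F (z.1, z.2, R) ∧ dP F (z.1, z.2, -R) < -A}, mem_nhdsWithin_of_mem_nhds
        ((c1.eventually_const_lt h1).and (c2.eventually_lt_const h2)), R, hR, fun z hz p => ?_⟩
      exact ⟨fun hp => hz.1.le.trans ((hF.strictMono_dP _ _).monotone hp),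
        fun hp => ((hF.strictMono_dP _ _).monotone hp).trans hz.2.le⟩
  obtain ⟨R, hR, h⟩ := key
  refine ⟨R, hR, fun t x p => ?_⟩
  have := h (Int.fract t, Int.fract x) ⟨⟨Int.fract_nonneg t, (Int.fract_lt_one t).le⟩,
    ⟨Int.fract_nonneg x, (Int.fract_lt_one x).le⟩⟩ p
  have e := hF.dP_add_int ⌊t⌋ ⌊x⌋ (Int.fract t) (Int.fract x) p
  rw [Int.fract_add_floor, Int.fract_add_floor] at e
  simp only [← e] at this
  exact this

theorem exists_bound (hF : Tonelli F) (R : ℝ) : ∃ C, ∀ t x p, |p| ≤ R → |F (t, x, p)| ≤ C := by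
  obtain ⟨C, hC⟩ := ((isCompact_Icc (a := (0 : ℝ)) (b := 1)).prod
    ((isCompact_Icc (a := (0 : ℝ)) (b := 1)).prod (isCompact_Icc (a := -R) (b := R)))
    ).exists_bound_of_continuousOn hF.continuous.continuousOn
  refine ⟨C, fun t x p hp => ?_⟩
  have := hC (Int.fract t, Int.fract x, p) ⟨⟨Int.fract_nonneg t, (Int.fract_lt_one t).le⟩,
    ⟨Int.fract_nonneg x, (Int.fract_lt_one x).le⟩, abs_le.1 hp⟩
  have e := hF.add_int ⌊t⌋ ⌊x⌋ (Int.fract t, Int.fract x, p)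
  simp only [Prod.mk_add_mk, Int.fract_add_floor, add_zero] at e
  rwa [e]

/-- Uniform coercivity of the Lagrangian in terms of the momentum. -/
theorem exists_forall_le_lagrangian (hF : Tonelli F) (A : ℝ) : ∃ R > 0, ∀ t x p,
    R ≤ |p| → A ≤ p * dP F (t, x, p) - F (t, x, p) := by
  obtain ⟨C, hC⟩ := hF.exists_bound 1
  obtain ⟨R, hR, h⟩ := hF.exists_forall_le_dP (A + C)
  refine ⟨R, hR, fun t x p hp => ?_⟩
  rcases le_abs.1 hp with hp | hp
  · have h1 := hF.tangent_le t x p 1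
    have h2 := (abs_le.1 (hC t x 1 (by simp))).2
    linarith [(h t x p).1 hp]
  · have h1 := hF.tangent_le t x p (-1)
    have h2 := (abs_le.1 (hC t x (-1) (by simp))).2
    linarith [(h t x p).2 (by linarith)]

end Tonelli

namespace IsOrbit

variable {F : ℝ × ℝ × ℝ → ℝ} {γ : ℝ → ℝ × ℝ}

theorem shift (h : IsOrbit F γ) (hF : Tonelli F) (n m : ℤ) :
    IsOrbit F fun t => γ (t + n) + ((m : ℝ), (0 : ℝ)) := by
  intro t
  have h1 := ((h (t + n)).comp_add_const t (n : ℝ)).add_const ((m : ℝ), (0 : ℝ))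
  have e : γ (t + n) + ((m : ℝ), (0 : ℝ)) = ((γ (t + n)).1 + m, (γ (t + n)).2) := by
    ext <;> simp
  have e1 := hF.dP_add_int n 0 t (γ (t + n)).1 (γ (t + n)).2
  have e2 := hF.dP_add_int 0 m t (γ (t + n)).1 (γ (t + n)).2
  have e3 := hF.dX_add_int n 0 t (γ (t + n)).1 (γ (t + n)).2
  have e4 := hF.dX_add_int 0 m t (γ (t + n)).1 (γ (t + n)).2
  simp only [Int.cast_zero, add_zero, Prod.mk.eta] at e1 e2 e3 e4
  simp only [e]
  rw [e2, e4, ← e1, ← e3]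
  exact h1

/-- Continuous dependence: orbits issued near `(t₀, γ₀ t₀)` stay close to `γ₀` for unit time. -/
theorem exists_nhds_dist_lt {γ₀ : ℝ → ℝ × ℝ} (hF : Tonelli F) (h₀ : IsOrbit F γ₀) (t₀ : ℝ) :
    ∃ V ∈ 𝓝 (t₀, γ₀ t₀), ∀ t, ∀ γ, IsOrbit F γ → (t, γ t) ∈ V →
      |t - t₀| ≤ 1 ∧ ∀ σ ∈ Icc t (t + 1), dist (γ₀ σ) (γ σ) < 1 := by
  obtain ⟨B, hB0, hB⟩ := h₀.exists_bound (t₀ - 1) (t₀ + 2)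
  obtain ⟨C, hC0, hC⟩ := hF.exists_taylor (B + 1)
  set X : ℝ → ℝ × ℝ → ℝ × ℝ := fun t z => (dP F (t, z), -dX F (t, z)) with hX
  have hLip : ∀ t, |t| ≤ B → LipschitzOnWith C.toNNReal (X t) (Metric.closedBall 0 (B + 1)) := by
    intro t ht
    apply LipschitzOnWith.of_dist_le_mul
    intro a ha b hb
    rw [mem_closedBall_zero_iff] at ha hb
    have mem : ∀ a : ℝ × ℝ, ‖a‖ ≤ B + 1 →
        ((t, a) : ℝ × ℝ × ℝ) ∈ Metric.closedBall (0 : ℝ × ℝ × ℝ) (B + 1) := by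
      intro a ha
      rw [mem_closedBall_zero_iff, Prod.norm_def]
      exact max_le (by simp only [Real.norm_eq_abs]; linarith) ha
    have h1 := (hC _ (mem b hb) _ (mem a ha)).1
    have e : ‖((t, a) : ℝ × ℝ × ℝ) - (t, b)‖ = dist a b := by
      rw [dist_eq_norm]; simp [Prod.norm_def]
    rw [e] at h1
    rw [Real.coe_toNNReal _ hC0]
    have hop : ∀ e : ℝ × ℝ × ℝ, ‖e‖ = 1 →
        |fderiv ℝ F (t, a) e - fderiv ℝ F (t, b) e| ≤ C * dist a b := by
      intro e he
      have h2 := (fderiv ℝ F (t, a) - fderiv ℝ F (t, b)).le_opNorm e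
      rw [he, mul_one] at h2
      exact h2.trans h1
    rw [Prod.dist_eq]
    refine max_le ?_ ?_
    · exact hop (0, 0, 1) (by simp [Prod.norm_def])
    · rw [hX]
      simp only [dist_neg_neg]
      exact hop (0, 1, 0) (by simp [Prod.norm_def])
  set K := C.toNNReal with hK
  set d := Real.exp (-(K : ℝ)) / 2 with hd
  have hd0 : 0 < d := by positivity
  have hd1 : d < 1 := by
    have : Real.exp (-(K : ℝ)) ≤ 1 := Real.exp_le_one_iff.2 (by simp)
    linarith
  have hcont : ContinuousAt (fun q : ℝ × ℝ × ℝ => dist (γ₀ q.1) q.2) (t₀, γ₀ t₀) := by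
    have := h₀.continuous
    fun_prop
  have hV := (hcont.eventually_lt_const (show _ < d by simpa using hd0)).and
    ((continuous_fst.continuousAt (x := (t₀, γ₀ t₀))).eventually
      (Metric.closedBall_mem_nhds t₀ one_pos))
  refine ⟨_, hV, fun t γ h ht => ⟨ht.2, ?_⟩⟩
  have ht1 : |t - t₀| ≤ 1 := ht.2
  have ht0 : dist (γ₀ t) (γ t) < d := ht.1
  rw [abs_le] at ht1
  by_contra! hex
  have hc := h.continuous
  have hc₀ := h₀.continuous
  have hKc : IsCompact (Icc t (t + 1) ∩ {σ | 1 ≤ dist (γ₀ σ) (γ σ)}) :=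
    isCompact_Icc.inter_right (isClosed_le continuous_const (by fun_prop))
  obtain ⟨σ, ⟨hσ, hσ1⟩, hmin⟩ := hKc.exists_isLeast hex
  have hin : ∀ s ∈ Ico t σ, dist (γ₀ s) (γ s) < 1 := by
    intro s hs
    by_contra! hge
    have := hmin ⟨⟨hs.1, hs.2.le.trans hσ.2⟩, hge⟩
    linarith [hs.2]
  have hbd : ∀ s ∈ Ico t σ, |s| ≤ B ∧ ‖γ₀ s‖ ≤ B := by
    intro s hs
    have := hB s ⟨by linarith [hs.1, ht1.1], by linarith [hs.2, hσ.2, ht1.2]⟩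
    exact ⟨this.1, max_le this.2.1 this.2.2⟩
  have := dist_le_of_trajectories_ODE_of_mem (v := X) (K := K)
    (s := fun _ => Metric.closedBall 0 (B + 1)) (f := γ₀) (g := γ) (a := t) (b := σ) (δ := d)
    (fun s hs => hLip s (hbd s hs).1) hc₀.continuousOn
    (fun s _ => (h₀ s).hasDerivWithinAt)
    (fun s hs => by rw [mem_closedBall_zero_iff]; linarith [(hbd s hs).2])
    hc.continuousOn (fun s _ => (h s).hasDerivWithinAt)
    (fun s hs => by
      rw [mem_closedBall_zero_iff]
      have h1 := (hbd s hs).2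
      have h2 := hin s hs
      rw [dist_eq_norm, norm_sub_rev] at h2
      have h3 := norm_le_norm_add_norm_sub' (γ s) (γ₀ s)
      linarith) ht0.le σ ⟨hσ.1, le_rfl⟩
  have hexp : d * Real.exp (K * (σ - t)) ≤ 1 / 2 := by
    have : Real.exp (K * (σ - t)) ≤ Real.exp K := by
      apply Real.exp_le_exp.2
      apply mul_le_of_le_one_right (by positivity)
      linarith [hσ.2]
    calc d * Real.exp (K * (σ - t)) ≤ d * Real.exp K := by gcongr
      _ = 1 / 2 := by
        rw [hd, div_mul_eq_mul_div, ← Real.exp_add]; simp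
  have : (1 : ℝ) ≤ dist (γ₀ σ) (γ σ) := hσ1
  linarith

/-- Momenta which are bounded at some time stay bounded for unit time, uniformly. -/
theorem exists_momentum_bound (hF : Tonelli F) (R : ℝ) : ∃ R', ∀ γ, IsOrbit F γ →
    ∀ t, |(γ t).2| ≤ R → ∀ σ ∈ Icc t (t + 1), |(γ σ).2| < R' := by
  have key : ∃ R', ∀ q ∈ Icc (0 : ℝ) 1 ×ˢ (Icc (0 : ℝ) 1 ×ˢ Icc (-R) R), ∀ γ, IsOrbit F γ →
      γ q.1 = q.2 → ∀ σ ∈ Icc q.1 (q.1 + 1), |(γ σ).2| < R' := by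
    apply (isCompact_Icc.prod (isCompact_Icc.prod isCompact_Icc)).induction_on
      (p := fun s : Set (ℝ × ℝ × ℝ) => ∃ R', ∀ q ∈ s, ∀ γ, IsOrbit F γ →
      γ q.1 = q.2 → ∀ σ ∈ Icc q.1 (q.1 + 1), |(γ σ).2| < R')
    · exact ⟨0, by simp⟩
    · rintro s t hst ⟨R', h⟩
      exact ⟨R', fun q hq => h q (hst hq)⟩
    · rintro s t ⟨R', h⟩ ⟨R'', h'⟩
      refine ⟨max R' R'', fun q hq γ hγ e σ hσ => ?_⟩
      rcases hq with hq | hq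
      · exact (h q hq γ hγ e σ hσ).trans_le (le_max_left _ _)
      · exact (h' q hq γ hγ e σ hσ).trans_le (le_max_right _ _)
    · rintro ⟨t₀, z₀⟩ -
      obtain ⟨γ₀, e₀, h₀⟩ := hF.complete t₀ z₀
      obtain ⟨V, hV, hV'⟩ := h₀.exists_nhds_dist_lt hF t₀
      obtain ⟨B, hB0, hB⟩ := h₀.exists_bound (t₀ - 1) (t₀ + 2)
      rw [e₀] at hV
      refine ⟨V, mem_nhdsWithin_of_mem_nhds hV, B + 1, ?_⟩
      rintro ⟨t, z⟩ hq γ hγ (rfl : γ t = z) σ (hσ : σ ∈ Icc t (t + 1))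
      obtain ⟨h1, h2⟩ := hV' t γ hγ hq
      rw [abs_le] at h1
      have h3 := (hB σ ⟨by linarith [hσ.1, h1.1], by linarith [hσ.2, h1.2]⟩).2.2
      have h4 := (le_max_right _ _).trans_lt (h2 σ hσ)
      rw [Real.dist_eq, abs_sub_comm] at h4
      have h5 := abs_add_le ((γ σ).2 - (γ₀ σ).2) (γ₀ σ).2
      rw [sub_add_cancel] at h5
      linarith
  obtain ⟨R', hR'⟩ := key
  refine ⟨R', fun γ hγ t ht σ hσ => ?_⟩
  have := hR' (Int.fract t, (Int.fract (γ t).1, (γ t).2))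
    ⟨⟨Int.fract_nonneg _, (Int.fract_lt_one _).le⟩,
      ⟨Int.fract_nonneg _, (Int.fract_lt_one _).le⟩, abs_le.1 ht⟩ _
    (hγ.shift hF ⌊t⌋ (-⌊(γ t).1⌋)) (by
      simp only [Int.fract_add_floor]
      ext
      · simp [Int.fract, sub_eq_add_neg]
      · simp) (σ - ⌊t⌋) (by
      simp only [Int.fract]
      exact ⟨by linarith [hσ.1], by linarith [hσ.2]⟩)
  simpa using this

end IsOrbit

/-- A bounded continuous function which is nowhere touched from below with slope `R`
has all its slopes bounded above by `R`. -/
theorem sub_le_of_not_touching {f : ℝ → ℝ} (hf : Continuous f) {M R : ℝ} (hM : ∀ x, |f x| ≤ M)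
    (hR : 0 < R) (h : ∀ x r, 0 < r → ¬ ∀ z, |z| ≤ r → f x + R * z ≤ f (x + z)) {y₁ y₂ : ℝ}
    (hy : y₁ ≤ y₂) : f y₂ - f y₁ ≤ R * (y₂ - y₁) := by
  by_contra! hneg
  have hM0 : 0 ≤ M := (abs_nonneg _).trans (hM 0)
  set e := y₁ - (2 * M + 1) / R with he
  have heR : R * e = R * y₁ - (2 * M + 1) := by rw [he]; field_simp
  have hey : e < y₁ := by
    have : 0 < (2 * M + 1) / R := by positivity
    linarith
  obtain ⟨x, hx, hxm⟩ := (isCompact_Icc (a := e) (b := y₂)).exists_isMinOn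
    ⟨y₁, hey.le, hy⟩ (f := fun y => f y - R * y) (by fun_prop)
  have h1 : f x - R * x ≤ f y₁ - R * y₁ := hxm ⟨hey.le, hy⟩
  have hxe : e < x := by
    refine lt_of_le_of_ne hx.1 fun h' => ?_
    rw [← h'] at h1
    linarith [(abs_le.1 (hM e)).1, (abs_le.1 (hM y₁)).2]
  have hxy : x < y₂ := by
    refine lt_of_le_of_ne hx.2 fun h' => ?_
    rw [h'] at h1
    linarith
  refine h x (min (x - e) (y₂ - x)) (lt_min (by linarith) (by linarith)) fun z hz => ?_
  have hz1 := abs_le.1 (hz.trans (min_le_left _ _))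
  have hz2 := abs_le.1 (hz.trans (min_le_right _ _))
  have : f x - R * x ≤ f (x + z) - R * (x + z) := hxm ⟨by linarith [hz1.1], by linarith [hz2.2]⟩
  linarith

section

variable {F : ℝ × ℝ × ℝ → ℝ} {t₀ : ℝ} {w : ℝ × ℝ → ℝ}

/-- Bounded solutions become equi-Lipschitz in space after unit time. -/
theorem exists_lipschitz_space (hF : Tonelli F)
    (hw : ContinuousOn w {z | t₀ < z.1}) (hsub : VSubsol (fun z q => F (z.1, z.2, q)) t₀ w)
    (hsup : VSupersol (fun z q => F (z.1, z.2, q)) t₀ w) {M : ℝ}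
    (hM : ∀ z : ℝ × ℝ, t₀ < z.1 → |w z| ≤ M) :
    ∃ R > 0, ∀ t, t₀ + 1 < t → ∀ x y, |w (t, x) - w (t, y)| ≤ R * |x - y| := by
  obtain ⟨R₀, hR₀, hL⟩ := hF.exists_forall_le_lagrangian (2 * M + 1)
  obtain ⟨R₁, hR₁⟩ := IsOrbit.exists_momentum_bound hF R₀
  have hmax : 0 < max R₁ 1 := lt_max_of_lt_right one_pos
  have no_touch : ∀ t, t₀ + 1 < t → ∀ P, R₁ ≤ |P| → ∀ x r, 0 < r →
      ¬ ∀ z, |z| ≤ r → w (t, x) + P * z ≤ w (t, x + z) := by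
    intro t ht P hP x r hr htouch
    obtain ⟨γ, hγt, hγ⟩ := hF.complete t (x, P)
    obtain ⟨a, ha, hat⟩ := hγ.exists_isAction hF t (w (t, (γ t).1))
    have key := eq_action_of_touching hF hw hsub hsup hγ ha (s := t - 1) (by linarith)
      (by linarith) hr hat (by simpa only [hγt] using htouch)
    have hp : ∀ s ∈ Icc (t - 1) t, R₀ ≤ |(γ s).2| := by
      intro s hs
      by_contra! hlt
      have := hR₁ γ hγ s hlt.le t ⟨hs.2, by linarith [hs.1]⟩
      rw [hγt] at this
      linarith
    have hac := ha.contDiff hγ hF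
    have := (convex_Icc (t - 1) t).mul_sub_le_image_sub_of_le_deriv
      hac.continuous.continuousOn (hac.differentiable one_ne_zero).differentiableOn
      (C := 2 * M + 1) (fun s hs => by
        rw [interior_Icc] at hs
        rw [(ha s).deriv]
        exact hL s (γ s).1 (γ s).2 (hp s ⟨hs.1.le, hs.2.le⟩))
      (t - 1) ⟨le_rfl, by linarith⟩ t ⟨by linarith, le_rfl⟩ (by linarith)
    have h1 := (abs_le.1 (hM (t - 1, (γ (t - 1)).1) (by simp only; linarith))).1
    have h2 := (abs_le.1 (hM (t, (γ t).1) (by simp only; linarith))).2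
    linarith
  refine ⟨max R₁ 1, hmax, fun t ht => ?_⟩
  have hfc : Continuous fun x => w (t, x) := by
    rw [← continuousOn_univ]
    exact hw.comp (by fun_prop) fun x _ => show t₀ < t by linarith
  have hfM : ∀ x, |w (t, x)| ≤ M := fun x => hM _ (show t₀ < t by linarith)
  have up : ∀ x y, x ≤ y → |w (t, x) - w (t, y)| ≤ max R₁ 1 * (y - x) := by
    intro x y hxy
    have h1 := sub_le_of_not_touching hfc hfM hmax
      (no_touch t ht _ ((le_max_left _ _).trans (le_abs_self _))) hxy
    have h2 := sub_le_of_not_touching (f := fun x => w (t, -x)) (hfc.comp continuous_neg)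
      (fun x => hfM _) hmax (fun x r hr h => by
        refine no_touch t ht (-max R₁ 1) ?_ (-x) r hr fun z hz => ?_
        · rw [abs_neg]; exact (le_max_left _ _).trans (le_abs_self _)
        · have := h (-z) (by rwa [abs_neg])
          rw [neg_add, neg_neg] at this
          linarith) (neg_le_neg hxy)
    simp only [neg_neg] at h2
    rw [abs_le]
    constructor <;> linarith
  intro x y
  rcases le_total x y with h | h
  · rw [abs_sub_comm x y, abs_of_nonneg (sub_nonneg.2 h)]; exact up x y h
  · rw [abs_sub_comm, abs_of_nonneg (sub_nonneg.2 h)]; exact up y x h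

/-- Supersolutions that are Lipschitz in space decrease at bounded speed. -/
theorem VSupersol.sub_le_of_lipschitz_space {G : ℝ × ℝ → ℝ → ℝ}
    (hG : Continuous fun q : (ℝ × ℝ) × ℝ => G q.1 q.2)
    (hw : ContinuousOn w {z | t₀ < z.1}) (h : VSupersol G t₀ w) {K C : ℝ} (hK : 0 < K)
    (hC : ∀ z q, |q| ≤ 2 * K → G z q < C) {s t : ℝ} (hs : t₀ < s) (hst : s ≤ t)
    (hL : ∀ τ ∈ Icc s t, ∀ x y, |w (τ, x) - w (τ, y)| ≤ K * |x - y|) (x : ℝ) :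
    w (s, x) - C * (t - s) ≤ w (t, x) := by
  by_contra! hneg
  set g := w (s, x) - C * (t - s) - w (t, x) with hg
  have hg0 : 0 < g := by linarith
  set N := K + 1 + 2 * K ^ 2 / g with hN
  have hdiv : 0 < 2 * K ^ 2 / g := by positivity
  have hN0 : 0 < N := by positivity
  have hNg : 2 * K ^ 2 < N * g := by
    have : 2 * K ^ 2 / g * g = 2 * K ^ 2 := by field_simp
    have h2 : 0 < (K + 1) * g := by positivity
    rw [hN]; linarith
  set φ : ℝ × ℝ → ℝ := fun y => -(C * (y.1 - s)) - N * (y.2 - x) ^ 2 with hφ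
  have hφC : ContDiff ℝ 1 φ := by simp only [hφ]; fun_prop
  set B := Icc s t ×ˢ Icc (x - 1) (x + 1) with hB
  have hBc : IsCompact B := isCompact_Icc.prod isCompact_Icc
  have hmem : ∀ τ ∈ Icc s t, (τ, x) ∈ B := fun τ hτ => ⟨hτ, by simp⟩
  obtain ⟨y, hyB, hy⟩ := hBc.exists_isMinOn ⟨_, hmem t ⟨hst, le_rfl⟩⟩
    (f := fun y => w y - φ y) ((hw.mono fun y hy => hs.trans_le hy.1.1).sub
      hφC.continuous.continuousOn)
  have hyt : w y - φ y ≤ w (t, x) - φ (t, x) := hy (hmem t ⟨hst, le_rfl⟩)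
  have hyc : w y - φ y ≤ w (y.1, x) - φ (y.1, x) := hy (hmem y.1 hyB.1)
  simp only [hφ, sub_self] at hyt hyc
  have hLy := (abs_le.1 (hL y.1 hyB.1 y.2 x)).1
  have hquad : N * |y.2 - x| ^ 2 ≤ K * |y.2 - x| := by
    rw [sq_abs]
    have : w y = w (y.1, y.2) := rfl
    linarith
  have hNK : N * |y.2 - x| ≤ K := by
    rcases (abs_nonneg (y.2 - x)).eq_or_lt' with h0 | h0
    · rw [h0, mul_zero]; exact hK.le
    · apply le_of_mul_le_mul_right _ h0
      linarith
  have hlt1 : |y.2 - x| < 1 := by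
    by_contra! hge
    have : N * 1 ≤ N * |y.2 - x| := by gcongr
    linarith
  have hys : s < y.1 := by
    refine lt_of_le_of_ne hyB.1.1 fun e => ?_
    have h1 : w y = w (s, y.2) := by rw [e]
    rw [← e] at hLy
    rw [h1, ← e] at hyt
    have h2 : g ≤ K * |y.2 - x| := by
      have : 0 ≤ N * (y.2 - x) ^ 2 := by positivity
      linarith
    have h3 : N * g ≤ K * K := by
      calc N * g ≤ N * (K * |y.2 - x|) := by gcongr
        _ = K * (N * |y.2 - x|) := by ring
        _ ≤ K * K := by gcongr
    have : 0 < K ^ 2 := by positivity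
    linarith
  have hloc : IsLocalMinOn (fun y => w y - φ y) {z | z.1 ≤ y.1} y := by
    rw [IsLocalMinOn, IsMinFilter, eventually_nhdsWithin_iff]
    have e1 : ∀ᶠ z : ℝ × ℝ in 𝓝 y, s < z.1 :=
      continuous_fst.continuousAt.eventually_const_lt hys
    have e2 : ∀ᶠ z : ℝ × ℝ in 𝓝 y, |z.2 - x| < 1 :=
      (show ContinuousAt (fun z : ℝ × ℝ => |z.2 - x|) y by fun_prop).eventually_lt_const hlt1
    filter_upwards [e1, e2] with z h1 h2 h3
    rw [abs_lt] at h2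
    exact hy ⟨⟨h1.le, h3.trans hyB.1.2⟩, by linarith [h2.1], by linarith [h2.2]⟩
  have key := h.of_isLocalMinOn hG hw hφC (hs.trans hys) hloc
  have hφd := hφC.differentiable one_ne_zero y
  have d1 : fderiv ℝ φ y (1, 0) = -C := by
    apply fderiv_apply_fst_of_hasDerivAt hφd
    have := (((hasDerivAt_id y.1).sub_const s).const_mul C).neg.sub_const (N * (y.2 - x) ^ 2)
    refine HasDerivAt.congr_deriv (f := fun _ => _) this ?_
    ring
  have d2 : fderiv ℝ φ y (0, 1) = -(2 * N * (y.2 - x)) := by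
    apply fderiv_apply_snd_of_hasDerivAt hφd
    have := ((((hasDerivAt_id y.2).sub_const x).pow 2).const_mul N).const_sub (-(C * (y.1 - s)))
    refine HasDerivAt.congr_deriv (f := fun _ => _) this ?_
    simp; ring
  rw [d1, d2] at key
  have := hC y (-(2 * N * (y.2 - x))) (by
    rw [abs_neg, abs_mul, abs_of_pos (by positivity)]
    linarith)
  linarith

/-- Bounded solutions become Lipschitz after unit time. -/
theorem exists_lipschitz (hF : Tonelli F)
    (hw : ContinuousOn w {z | t₀ < z.1}) (hsub : VSubsol (fun z q => F (z.1, z.2, q)) t₀ w)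
    (hsup : VSupersol (fun z q => F (z.1, z.2, q)) t₀ w) {M : ℝ}
    (hM : ∀ z : ℝ × ℝ, t₀ < z.1 → |w z| ≤ M) :
    ∃ L, 0 ≤ L ∧ ∀ z z' : ℝ × ℝ, t₀ + 1 < z.1 → t₀ + 1 < z'.1 → |w z - w z'| ≤ L * dist z z' := by
  obtain ⟨K, hK, hL⟩ := exists_lipschitz_space hF hw hsub hsup hM
  obtain ⟨C, hC⟩ := hF.exists_bound (2 * K)
  have hC0 : 0 ≤ C := (abs_nonneg _).trans (hC 0 0 0 (by simpa using hK.le))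
  have hFc := hF.continuous
  have htime : ∀ s t x, t₀ + 1 < s → s ≤ t → |w (s, x) - w (t, x)| ≤ (C + 1) * (t - s) := by
    intro s t x hs hst
    have h1 := hsup.sub_le_of_lipschitz_space (C := C + 1) (by fun_prop) hw hK
      (fun z q hq => by linarith [(abs_le.1 (hC z.1 z.2 q hq)).2]) (by linarith) hst
      (fun τ hτ => hL τ (hs.trans_le hτ.1)) x
    have h2 := hsub.neg.sub_le_of_lipschitz_space (C := C + 1) (by fun_prop) hw.neg hK
      (fun z q hq => by linarith [(abs_le.1 (hC z.1 z.2 (-q) (by rwa [abs_neg]))).1])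
      (by linarith) hst
      (fun τ hτ x y => by
        have := hL τ (hs.trans_le hτ.1) x y
        rw [abs_sub_comm] at this
        convert this using 2
        simp only [Pi.neg_apply]; ring) x
    simp only [Pi.neg_apply] at h2
    rw [abs_le]
    constructor <;> linarith
  refine ⟨K + (C + 1), by positivity, fun z z' hz hz' => ?_⟩
  have h1 := hL z.1 hz z.2 z'.2
  have h2 : |w (z.1, z'.2) - w (z'.1, z'.2)| ≤ (C + 1) * |z.1 - z'.1| := by
    rcases le_total z.1 z'.1 with h | h
    · rw [abs_sub_comm z.1, abs_of_nonneg (sub_nonneg.2 h)]; exact htime _ _ _ hz h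
    · rw [abs_sub_comm, abs_of_nonneg (sub_nonneg.2 h)]; exact htime _ _ _ hz' h
  have h3 : |z.1 - z'.1| ≤ dist z z' := le_max_left _ _
  have h4 : |z.2 - z'.2| ≤ dist z z' := le_max_right _ _
  calc |w z - w z'| ≤ |w (z.1, z.2) - w (z.1, z'.2)| + |w (z.1, z'.2) - w (z'.1, z'.2)| :=
        abs_sub_le _ _ _
    _ ≤ K * dist z z' + (C + 1) * dist z z' := by
        have := mul_le_mul_of_nonneg_left h4 hK.le
        have := mul_le_mul_of_nonneg_left h3 (show 0 ≤ C + 1 by positivity)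
        linarith
    _ = (K + (C + 1)) * dist z z' := by ring

end

/-- `v` is the pointwise lower limit of `W`. -/
structure IsLowerLimit (W : ℕ → ℝ × ℝ → ℝ) (v : ℝ × ℝ → ℝ) : Prop where
  eventually_lt : ∀ z, ∀ ε > 0, ∀ᶠ n in atTop, v z - ε < W n z
  frequently_lt : ∀ z, ∀ ε > 0, ∃ᶠ n in atTop, W n z < v z + ε

/-- Lipschitz bounds on half planes, uniform for large indices. -/
def EventuallyLipschitz (L : ℝ) (W : ℕ → ℝ × ℝ → ℝ) : Prop :=
  ∀ T : ℝ, ∀ᶠ n in atTop, ∀ z z' : ℝ × ℝ, T < z.1 → T < z'.1 → |W n z - W n z'| ≤ L * dist z z'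

namespace IsLowerLimit

variable {W : ℕ → ℝ × ℝ → ℝ} {v : ℝ × ℝ → ℝ} {L : ℝ}

theorem sub_le (h : IsLowerLimit W v) (hL : EventuallyLipschitz L W) (z z' : ℝ × ℝ) :
    v z - v z' ≤ L * dist z z' := by
  refine le_of_forall_pos_le_add fun ε hε => ?_
  obtain ⟨n, h1, h2, h3⟩ := ((h.frequently_lt z' (ε / 2) (by positivity)).and_eventually
    ((h.eventually_lt z (ε / 2) (by positivity)).and
      (hL (min z.1 z'.1 - 1)))).exists
  have := (abs_le.1 (h3 z z' (by linarith [min_le_left z.1 z'.1])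
    (by linarith [min_le_right z.1 z'.1]))).2
  linarith

theorem continuous (h : IsLowerLimit W v) (hL0 : 0 ≤ L) (hL : EventuallyLipschitz L W) :
    Continuous v :=
  (LipschitzWith.of_le_add_mul ⟨L, hL0⟩ fun z z' => by
    have := h.sub_le hL z z'
    change v z ≤ v z' + L * dist z z'
    linarith).continuous

/-- The lower bounds are locally uniform. -/
theorem eventually_forall_lt (h : IsLowerLimit W v) (hL0 : 0 ≤ L) (hL : EventuallyLipschitz L W)
    {K : Set (ℝ × ℝ)} (hK : IsCompact K) {ε : ℝ} (hε : 0 < ε) :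
    ∀ᶠ n in atTop, ∀ z ∈ K, v z - ε < W n z := by
  refine hK.induction_on (p := fun s => ∀ᶠ n in atTop, ∀ z ∈ s, v z - ε < W n z) (by simp)
    (fun s t hst ht => ht.mono fun n hn z hz => hn z (hst hz))
    (fun s t hs ht => (hs.and ht).mono fun n hn z hz => hz.elim (hn.1 z) (hn.2 z)) fun z _ => ?_
  have hρ : 0 < min 1 (ε / (4 * (L + 1))) := by positivity
  refine ⟨Metric.ball z _, mem_nhdsWithin_of_mem_nhds (Metric.ball_mem_nhds z hρ), ?_⟩
  filter_upwards [h.eventually_lt z (ε / 2) (by positivity), hL (z.1 - 1)] with n h1 h2 y hy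
  rw [Metric.mem_ball, lt_min_iff] at hy
  have hy1 : |y.1 - z.1| < 1 := (le_max_left _ _ : dist y.1 z.1 ≤ dist y z).trans_lt hy.1
  have e1 := (abs_le.1 (h2 y z (by linarith [(abs_lt.1 hy1).1]) (by linarith))).1
  have e2 := h.sub_le hL y z
  have e3 : L * dist y z ≤ ε / 4 := by
    have := hy.2
    rw [lt_div_iff₀ (by positivity)] at this
    nlinarith [dist_nonneg (x := y) (y := z)]
  linarith

/-- A lower limit of supersolutions is a supersolution. -/
theorem vsupersol (h : IsLowerLimit W v) (hL0 : 0 ≤ L) (hL : EventuallyLipschitz L W)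
    {G : ℝ × ℝ → ℝ → ℝ} (hG : Continuous fun q : (ℝ × ℝ) × ℝ => G q.1 q.2)
    (hW : ∀ T, ∀ᶠ n in atTop, VSupersol G T (W n)) (T : ℝ) : VSupersol G T v := by
  intro φ hφ z _ hmin
  by_contra! hneg
  have hdφ : Continuous (fderiv ℝ φ) := hφ.continuous_fderiv one_ne_zero
  set Ψ : ℝ × ℝ → ℝ := fun y => fderiv ℝ φ y (1, 0) - 2 * (y.1 - z.1) +
    G y (fderiv ℝ φ y (0, 1) - 2 * (y.2 - z.2)) with hΨ
  have hΨc : Continuous Ψ := by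
    have h1 : Continuous fun y => fderiv ℝ φ y (1, 0) := hdφ.clm_apply continuous_const
    have h2 : Continuous fun y => fderiv ℝ φ y (0, 1) := hdφ.clm_apply continuous_const
    have h3 : Continuous fun y : ℝ × ℝ =>
        G y (fderiv ℝ φ y (0, 1) - 2 * (y.2 - z.2)) :=
      hG.comp (continuous_id.prodMk (by fun_prop))
    simp only [hΨ]; fun_prop
  have hΨz : Ψ z < 0 := by simpa [hΨ] using hneg
  have e1 : ∀ᶠ y in 𝓝 z, Ψ y < 0 := hΨc.continuousAt.eventually_lt_const hΨz
  obtain ⟨r, hr, hball⟩ := Metric.nhds_basis_closedBall.eventually_iff.1 (e1.and hmin)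
  set ψ : ℝ × ℝ → ℝ := fun y => φ y - ((y.1 - z.1) ^ 2 + (y.2 - z.2) ^ 2) with hψ
  have hψc : ContDiff ℝ 1 ψ := by simp only [hψ]; fun_prop
  have hε : 0 < r ^ 2 / 4 := by positivity
  have hKc := isCompact_closedBall z r
  have hfst : ∀ y ∈ Metric.closedBall z r, z.1 - r - 1 < y.1 := by
    intro y hy
    have : |y.1 - z.1| ≤ r := (le_max_left _ _ : dist y.1 z.1 ≤ dist y z).trans hy
    linarith [(abs_le.1 this).1]
  obtain ⟨n, hn1, hn2, hn3, hn4⟩ := ((h.frequently_lt z _ hε).and_eventually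
    ((h.eventually_forall_lt hL0 hL hKc hε).and ((hL (z.1 - r - 1)).and
      (hW (z.1 - r - 1))))).exists
  have hcont : ContinuousOn (W n) (Metric.closedBall z r) :=
    (LipschitzOnWith.of_dist_le_mul (K := ⟨L, hL0⟩) fun a ha b hb =>
      hn3 a b (hfst a ha) (hfst b hb)).continuousOn
  obtain ⟨y, hyK, hymin⟩ := hKc.exists_isMinOn ⟨z, by simp [hr.le]⟩
    (hcont.sub hψc.continuous.continuousOn)
  have hyz := hymin (show z ∈ Metric.closedBall z r by simp [hr.le])
  simp only [mem_ofPred_eq, Pi.sub_apply] at hyz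
  have hψz : ψ z = φ z := by simp [hψ]
  have h1 := hn2 y hyK
  have h2 := (hball hyK).2
  simp only at h2
  have hlt : (y.1 - z.1) ^ 2 + (y.2 - z.2) ^ 2 < r ^ 2 := by
    have e : ψ y = φ y - ((y.1 - z.1) ^ 2 + (y.2 - z.2) ^ 2) := rfl
    rw [hψz, e] at hyz
    linarith
  have hyb : dist y z < r := by
    rw [Prod.dist_eq, Real.dist_eq, Real.dist_eq]
    exact max_lt (abs_lt_of_sq_lt_sq (by linarith [sq_nonneg (y.2 - z.2)]) hr.le)
      (abs_lt_of_sq_lt_sq (by linarith [sq_nonneg (y.1 - z.1)]) hr.le)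
  have hloc : IsLocalMin (fun a => W n a - ψ a) y := by
    filter_upwards [Metric.isOpen_ball.mem_nhds hyb] with a ha
    exact hymin (Metric.ball_subset_closedBall ha)
  have key := hn4 ψ hψc y (hfst y hyK) hloc
  have hψd := hψc.differentiable one_ne_zero y
  have hφd := hφ.differentiable one_ne_zero y
  have d1 : fderiv ℝ ψ y (1, 0) = fderiv ℝ φ y (1, 0) - 2 * (y.1 - z.1) := by
    apply fderiv_apply_fst_of_hasDerivAt hψd
    have := (hasDerivAt_fst_of_differentiableAt hφd).sub
      ((((hasDerivAt_id y.1).sub_const z.1).pow 2).add_const ((y.2 - z.2) ^ 2))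
    refine HasDerivAt.congr_deriv (f := fun _ => _) this ?_
    simp
  have d2 : fderiv ℝ ψ y (0, 1) = fderiv ℝ φ y (0, 1) - 2 * (y.2 - z.2) := by
    apply fderiv_apply_snd_of_hasDerivAt hψd
    have := (hasDerivAt_snd_of_differentiableAt hφd).sub
      ((((hasDerivAt_id y.2).sub_const z.2).pow 2).const_add ((y.1 - z.1) ^ 2))
    refine HasDerivAt.congr_deriv (f := fun _ => _) this ?_
    simp
  rw [d1, d2] at key
  exact absurd (hball hyK).1 (not_lt.2 key)

/-- For Tonelli Hamiltonians, a lower limit of subsolutions is a subsolution. -/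
theorem vsubsol (h : IsLowerLimit W v) (hL0 : 0 ≤ L) (hL : EventuallyLipschitz L W)
    {F : ℝ × ℝ × ℝ → ℝ} (hF : Tonelli F)
    (hW : ∀ T, ∀ᶠ n in atTop, VSubsol (fun z q => F (z.1, z.2, q)) T (W n)) (T : ℝ) :
    VSubsol (fun z q => F (z.1, z.2, q)) T v := by
  intro φ hφ z _ hmax
  have hφd := hφ.differentiable one_ne_zero z
  set P := fderiv ℝ φ z (0, 1) with hP
  set V := dP F (z.1, z.2, P) with hV
  refine le_of_forall_pos_le_add fun ε hε => ?_
  obtain ⟨D, ρ, hD, hρ, hleg⟩ := hF.exists_legendre_le (max (max (|z.1| + 1) (|z.2| + 1)) |P|)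
  have hdPc : Continuous fun y : ℝ × ℝ => dP F (y.1, y.2, P) :=
    hF.contDiff_dP.continuous.comp (by fun_prop)
  have hFc : Continuous fun y : ℝ × ℝ => F (y.1, y.2, P) := hF.continuous.comp (by fun_prop)
  have e1 : ∀ᶠ y : ℝ × ℝ in 𝓝 z, |V - dP F (y.1, y.2, P)| < ρ :=
    (continuous_const.sub hdPc).abs.continuousAt.eventually_lt_const (by simpa [hV] using hρ)
  have e2 : ∀ᶠ y : ℝ × ℝ in 𝓝 z,
      -F (y.1, y.2, P) + D * (V - dP F (y.1, y.2, P)) ^ 2 < -F (z.1, z.2, P) + ε :=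
    (show Continuous fun y : ℝ × ℝ =>
        -F (y.1, y.2, P) + D * (V - dP F (y.1, y.2, P)) ^ 2 from
      hFc.neg.add (((continuous_const.sub hdPc).pow 2).const_mul D)).continuousAt.eventually_lt_const (by simpa [hV] using hε)
  obtain ⟨r, hr, hball⟩ := Metric.eventually_nhds_iff.1 (e1.and e2)
  -- the Lagrangian is controlled near `z`
  have hlag : ∀ t x q, |t - z.1| < min r 1 → |x - z.2| < min r 1 →
      q * V - F (t, x, q) ≤ P * V - F (z.1, z.2, P) + ε := by
    intro t x q ht hx
    rw [lt_min_iff] at ht hx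
    obtain ⟨h1, h2⟩ := hball (y := (t, x)) (max_lt ht.1 hx.1)
    have ht' : |t| ≤ |z.1| + 1 := by
      have := abs_sub_abs_le_abs_sub t z.1
      linarith [ht.2]
    have hx' : |x| ≤ |z.2| + 1 := by
      have := abs_sub_abs_le_abs_sub x z.2
      linarith [hx.2]
    have := hleg t x P V q (ht'.trans ((le_max_left _ _).trans (le_max_left _ _)))
      (hx'.trans ((le_max_right _ _).trans (le_max_left _ _))) (le_max_right _ _) h1.le
    linarith
  have hr' : 0 < min r 1 := lt_min hr one_pos
  have hdom : ∀ σ, 0 < σ → σ < min r 1 → |V| * σ < min r 1 / 2 →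
      v z - v (z.1 - σ, z.2 - V * σ) ≤ (P * V - F (z.1, z.2, P) + ε) * σ := by
    intro σ hσ hσr hVσ
    refine le_of_forall_pos_le_add fun ε' hε' => ?_
    obtain ⟨n, hn1, hn2, hn3, hn4⟩ := ((h.frequently_lt (z.1 - σ, z.2 - V * σ) (ε' / 2)
      (by positivity)).and_eventually ((h.eventually_lt z (ε' / 2) (by positivity)).and
        ((hL (z.1 - 2)).and (hW (z.1 - 2))))).exists
    have hcont : ContinuousOn (W n) {y | z.1 - 2 < y.1} :=
      (LipschitzOnWith.of_dist_le_mul (K := ⟨L, hL0⟩) fun a ha b hb =>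
        hn3 a b ha hb).continuousOn
    have hη : ∀ t, HasDerivAt (fun t => z.2 + V * (t - z.1)) V t := fun t => by
      have := (((hasDerivAt_id t).sub_const z.1).const_mul V).const_add z.2
      refine HasDerivAt.congr_deriv (f := fun _ => _) this ?_
      simp
    have hA : ∀ t, HasDerivAt (fun t => (P * V - F (z.1, z.2, P) + ε) * t)
        (P * V - F (z.1, z.2, P) + ε) t := fun t => by
      have := (hasDerivAt_id t).const_mul (P * V - F (z.1, z.2, P) + ε)
      refine HasDerivAt.congr_deriv (f := fun _ => _) this ?_
      simp
    have := hn4.sub_le_of_curve hF.continuous hcont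
      (η := fun t => z.2 + V * (t - z.1)) (A := fun t => (P * V - F (z.1, z.2, P) + ε) * t)
      (by fun_prop) (by fun_prop) (τ := z.1 - σ) (t₁ := z.1)
      (by linarith [min_le_right r 1]) (by linarith) (fun ε'' hε'' => by
        refine ⟨min r 1 / 2 * (1 / 2), by positivity, fun t ht x hx q => ?_⟩
        rw [(hη t).deriv, (hA t).deriv]
        have ht1 : |t - z.1| ≤ σ := by
          rw [abs_le]; constructor <;> linarith [ht.1, ht.2]
        refine (hlag t x q (ht1.trans_lt hσr) ?_).trans (by linarith)
        have e3 : |V * (t - z.1)| ≤ |V| * σ := by rw [abs_mul]; gcongr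
        have e4 := abs_add_le (x - (z.2 + V * (t - z.1))) (V * (t - z.1))
        have e5 : x - (z.2 + V * (t - z.1)) + V * (t - z.1) = x - z.2 := by ring
        rw [e5] at e4
        linarith)
    simp only [sub_self, mul_zero, add_zero, Prod.mk.eta] at this
    have e6 : z.2 + V * (z.1 - σ - z.1) = z.2 - V * σ := by ring
    rw [e6] at this
    linarith
  -- differentiate along the line
  have hline : HasDerivAt (fun σ : ℝ => ((z.1 - σ, z.2 - V * σ) : ℝ × ℝ)) (-1, -V) 0 := by
    have h1 := ((hasDerivAt_id (0 : ℝ)).const_sub z.1)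
    have h2 := (((hasDerivAt_id (0 : ℝ)).const_mul V).const_sub z.2)
    simpa using h1.prodMk h2
  have hz0 : ((z.1 - 0, z.2 - V * 0) : ℝ × ℝ) = z := by simp
  have hφl : HasDerivAt (fun σ : ℝ => φ (z.1 - σ, z.2 - V * σ)) (fderiv ℝ φ z (-1, -V)) 0 :=
    HasFDerivAt.comp_hasDerivAt (0 : ℝ) (l := φ) (by rw [hz0]; exact hφd.hasFDerivAt) hline
  have hval : fderiv ℝ φ z (-1, -V) = -(fderiv ℝ φ z (1, 0) + V * P) := by
    have : ((-1, -V) : ℝ × ℝ) = -((1, 0) + V • (0, 1)) := by ext <;> simp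
    rw [this, map_neg, map_add, map_smul, smul_eq_mul]
  have hslope := hφl.tendsto_slope_zero_right
  have hlb : ∀ᶠ σ in 𝓝[>] (0 : ℝ), -(P * V - F (z.1, z.2, P) + ε) ≤
      σ⁻¹ • (φ (z.1 - (0 + σ), z.2 - V * (0 + σ)) - φ (z.1 - 0, z.2 - V * 0)) := by
    have m1 : ∀ᶠ σ : ℝ in 𝓝 0, σ < min r 1 := eventually_lt_nhds hr'
    have m2 : ∀ᶠ σ : ℝ in 𝓝 0, |V| * σ < min r 1 / 2 :=
      (show Continuous fun σ : ℝ => |V| * σ by fun_prop).continuousAt.eventually_lt_const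
        (by simpa using hr')
    have m3 : ∀ᶠ σ : ℝ in 𝓝 0, v (z.1 - σ, z.2 - V * σ) - φ (z.1 - σ, z.2 - V * σ) ≤
        v z - φ z := by
      have := hline.continuousAt.tendsto
      rw [hz0] at this
      exact this.eventually hmax
    filter_upwards [self_mem_nhdsWithin, nhdsWithin_le_nhds m1, nhdsWithin_le_nhds m2,
      nhdsWithin_le_nhds m3] with σ hσ h1 h2 h3
    have hσ' : 0 < σ := hσ
    have := hdom σ hσ h1 h2
    rw [zero_add, hz0, smul_eq_mul, ← div_eq_inv_mul, le_div_iff₀ hσ']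
    linarith
  have := ge_of_tendsto hslope hlb
  rw [hval] at this
  simp only [zero_add]
  linarith

end IsLowerLimit

noncomputable section

/-- The normalised Hamiltonian `H(t, x, c + p) - a`. -/
def shiftHam (H : ℝ → ℝ → ℝ → ℝ) (c a : ℝ) (q : ℝ × ℝ × ℝ) : ℝ := H q.1 q.2.1 (c + q.2.2) - a

end

namespace BurgersHyp

variable {H : ℝ → ℝ → ℝ → ℝ}

theorem contDiff_shiftHam (hH : BurgersHyp H) (c a : ℝ) : ContDiff ℝ 2 (shiftHam H c a) :=
  (hH.smooth.comp (g := fun q : ℝ × ℝ × ℝ => H q.1 q.2.1 q.2.2)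
      (f := fun q : ℝ × ℝ × ℝ => (q.1, q.2.1, c + q.2.2)) (by fun_prop)).sub contDiff_const

theorem dP_shiftHam (hH : BurgersHyp H) (c a t x p : ℝ) :
    dP (shiftHam H c a) (t, x, p) = deriv (fun p => H t x p) (c + p) := by
  have hs := hH.contDiff_shiftHam c a
  have h1 := (hasDerivAt_p (hs.differentiable two_ne_zero (t, x, p))).deriv
  rw [dP, ← h1]
  simp only [shiftHam, deriv_sub_const]
  exact deriv_comp_const_add (f := fun p => H t x p) c p

theorem dX_shiftHam (hH : BurgersHyp H) (c a t x p : ℝ) :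
    dX (shiftHam H c a) (t, x, p) = deriv (fun x => H t x (c + p)) x := by
  have hs := hH.contDiff_shiftHam c a
  have h1 := (hasDerivAt_x (hs.differentiable two_ne_zero (t, x, p))).deriv
  rw [dX, ← h1]
  simp only [shiftHam, deriv_sub_const]

theorem tonelli (hH : BurgersHyp H) (c a : ℝ) : Tonelli (shiftHam H c a) where
  smooth := hH.contDiff_shiftHam c a
  per_t t x p := by simp [shiftHam, hH.per_t]
  per_x t x p := by simp [shiftHam, hH.per_x]
  pos := by
    rintro ⟨t, x, p⟩
    have hd : ContDiff ℝ 1 (dP (shiftHam H c a)) :=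
      ((hH.contDiff_shiftHam c a).fderiv_right (by norm_num)).clm_apply contDiff_const
    have h1 := (hasDerivAt_p (hd.differentiable one_ne_zero (t, x, p))).deriv
    have h2 := hH.convexp t x (c + p)
    rw [iteratedDeriv_succ, iteratedDeriv_one] at h2
    rw [← h1]
    simp only [hH.dP_shiftHam]
    rwa [deriv_comp_const_add (f := deriv fun p => H t x p)]
  superlinear t x := by
    refine tendsto_atTop.2 fun A => ?_
    have h1 := ((hH.superlinear t x).comp (tendsto_const_add_cobounded c)).eventually_ge_atTop
      (2 * (|A| + |a|))
    have h2 : ∀ᶠ p : ℝ in Bornology.cobounded ℝ, max 1 (2 * |c| + 1) ≤ ‖p‖ :=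
      tendsto_norm_cobounded_atTop.eventually_ge_atTop _
    filter_upwards [h1, h2] with p hp1 hp2
    rw [Real.norm_eq_abs, max_le_iff] at hp2
    have h3 : |p| ≤ |c + p| + |c| := by
      have := abs_sub (c + p) c
      rwa [add_sub_cancel_left] at this
    have h4 : 0 < |c + p| := by linarith [abs_nonneg c]
    have h5 : |p| ≤ 2 * |c + p| := by linarith
    simp only [Function.comp_apply] at hp1
    rw [le_div_iff₀ h4] at hp1
    rw [le_div_iff₀ (by linarith), shiftHam]
    have h6 : (|A| + |a|) * |p| ≤ (|A| + |a|) * (2 * |c + p|) := by gcongr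
    have h7 : A * |p| ≤ |A| * |p| := by gcongr; exact le_abs_self A
    have h8 : |a| * 1 ≤ |a| * |p| := by gcongr; exact hp2.1
    linarith [le_abs_self a]
  complete s z := by
    obtain ⟨γ, h0, h1⟩ := hH.complete s (z + (0, c))
    refine ⟨fun t => γ t - (0, c), by simp [h0], fun t => ?_⟩
    have := (h1 t).sub_const ((0, c) : ℝ × ℝ)
    rw [hH.dP_shiftHam, hH.dX_shiftHam]
    simpa [HamVF] using this

end BurgersHyp

theorem VSubsol.shift {G : ℝ × ℝ → ℝ → ℝ} {t₀ : ℝ} {w : ℝ × ℝ → ℝ} (h : VSubsol G t₀ w)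
    (b : ℝ × ℝ) : VSubsol (fun z => G (z + b)) (t₀ - b.1) (fun z => w (z + b)) := by
  intro φ hφ z hz hmax
  have e := fderiv_comp_add_right (𝕜 := ℝ) (f := fun y => φ (y - b)) (x := z) b
  simp only [add_sub_cancel_right] at e
  have := h (fun y => φ (y - b)) (hφ.comp (by fun_prop)) (z + b)
    (by simp only [Prod.fst_add]; linarith) (by
      have ht : Tendsto (fun y : ℝ × ℝ => y - b) (𝓝 (z + b)) (𝓝 z) := by
        have : Continuous fun y : ℝ × ℝ => y - b := by fun_prop
        simpa using this.tendsto (z + b)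
      filter_upwards [ht.eventually hmax] with y hy
      simpa using hy)
  rwa [← e] at this

theorem VSupersol.shift {G : ℝ × ℝ → ℝ → ℝ} {t₀ : ℝ} {w : ℝ × ℝ → ℝ} (h : VSupersol G t₀ w)
    (b : ℝ × ℝ) : VSupersol (fun z => G (z + b)) (t₀ - b.1) (fun z => w (z + b)) := by
  intro φ hφ z hz hmin
  have e := fderiv_comp_add_right (𝕜 := ℝ) (f := fun y => φ (y - b)) (x := z) b
  simp only [add_sub_cancel_right] at e
  have := h (fun y => φ (y - b)) (hφ.comp (by fun_prop)) (z + b)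
    (by simp only [Prod.fst_add]; linarith) (by
      have ht : Tendsto (fun y : ℝ × ℝ => y - b) (𝓝 (z + b)) (𝓝 z) := by
        have : Continuous fun y : ℝ × ℝ => y - b := by fun_prop
        simpa using this.tendsto (z + b)
      filter_upwards [ht.eventually hmin] with y hy
      simpa using hy)
  rwa [← e] at this

theorem fderiv_sub_fst_mul {φ : ℝ × ℝ → ℝ} (hφ : ContDiff ℝ 1 φ) (a : ℝ) (z : ℝ × ℝ) :
    fderiv ℝ (fun y : ℝ × ℝ => φ y - y.1 * a) z (1, 0) = fderiv ℝ φ z (1, 0) - a ∧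
    fderiv ℝ (fun y : ℝ × ℝ => φ y - y.1 * a) z (0, 1) = fderiv ℝ φ z (0, 1) := by
  have hd : DifferentiableAt ℝ (fun y : ℝ × ℝ => φ y - y.1 * a) z :=
    (hφ.differentiable one_ne_zero z).sub (by fun_prop)
  have hφd := hφ.differentiable one_ne_zero z
  constructor
  · apply fderiv_apply_fst_of_hasDerivAt hd
    have := (hasDerivAt_fst_of_differentiableAt hφd).sub ((hasDerivAt_id z.1).mul_const a)
    refine HasDerivAt.congr_deriv (f := fun _ => _) this ?_
    simp
  · apply fderiv_apply_snd_of_hasDerivAt hd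
    exact (hasDerivAt_snd_of_differentiableAt hφd).sub_const (z.1 * a)

theorem ViscSubSol.vsubsol {H : ℝ → ℝ → ℝ → ℝ} {c a t₀ : ℝ} {u : ℝ → ℝ → ℝ}
    (h : ViscSubSol H c 0 (Ioi t₀ ×ˢ univ) u) :
    VSubsol (fun z q => shiftHam H c a (z.1, z.2, q)) t₀ (fun z => u z.1 z.2 + z.1 * a) := by
  intro φ hφ z hz hmax
  have := h (fun y => φ y - y.1 * a) (hφ.sub (by fun_prop)) z ⟨hz, mem_univ _⟩
    (hmax.congr (Eventually.of_forall fun y => by ring))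
  rw [(fderiv_sub_fst_mul hφ a z).1, (fderiv_sub_fst_mul hφ a z).2] at this
  simp only [shiftHam]
  linarith

theorem ViscSuperSol.vsupersol {H : ℝ → ℝ → ℝ → ℝ} {c a t₀ : ℝ} {u : ℝ → ℝ → ℝ}
    (h : ViscSuperSol H c 0 (Ioi t₀ ×ˢ univ) u) :
    VSupersol (fun z q => shiftHam H c a (z.1, z.2, q)) t₀ (fun z => u z.1 z.2 + z.1 * a) := by
  intro φ hφ z hz hmin
  have := h (fun y => φ y - y.1 * a) (hφ.sub (by fun_prop)) z ⟨hz, mem_univ _⟩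
    (hmin.congr (Eventually.of_forall fun y => by ring))
  rw [(fderiv_sub_fst_mul hφ a z).1, (fderiv_sub_fst_mul hφ a z).2] at this
  simp only [shiftHam]
  linarith

/-- The lower limit of a sequence which is bounded at every point. -/
theorem isLowerLimit_liminf {W : ℕ → ℝ × ℝ → ℝ} {M : ℝ}
    (hM : ∀ z, ∀ᶠ n in atTop, |W n z| ≤ M) :
    IsLowerLimit W fun z => liminf (fun n => W n z) atTop where
  eventually_lt z _ hε := eventually_lt_of_lt_liminf (sub_lt_self _ hε)
    (isBoundedUnder_of_eventually_ge ((hM z).mono fun _ hn => (abs_le.1 hn).1))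
  frequently_lt z _ hε := frequently_lt_of_liminf_lt
    (isBoundedUnder_of_eventually_le
      ((hM z).mono fun _ hn => (abs_le.1 hn).2)).isCoboundedUnder_ge (lt_add_of_pos_right _ hε)

/-- if `u` is a viscosity solution of `(HJc)` on `[t₀,∞) × 𝕋` and
`u + tα(c)` is bounded, then `v(θ,x) = liminf_{t→∞, t ≡ θ (mod 1)} (u(t,x) + tα(c))` is a
`1`-periodic (in both variables) viscosity solution of `∂_θ v + H(θ,x,c+∂_x v) = α(c)`. -/
theorem stmt_8 (H : ℝ → ℝ → ℝ → ℝ) (hH : BurgersHyp H) (c a t₀ : ℝ) (u : ℝ → ℝ → ℝ)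
    (hu : IsViscSolOn H c t₀ u)
    (hb : ∃ M, ∀ t ∈ Ici t₀, ∀ x, |u t x + t * a| ≤ M)
    (v : ℝ → ℝ → ℝ)
    (hv : ∀ θ x, v θ x = liminf (fun n : ℕ => u (θ + n) x + (θ + n) * a) atTop) :
    Continuous (fun z : ℝ × ℝ => v z.1 z.2) ∧
    (∀ θ x, v (θ + 1) x = v θ x) ∧ (∀ θ x, v θ (x + 1) = v θ x) ∧
    ViscSol H c a univ v := by
  obtain ⟨hcont, hper, hsub, hsup⟩ := hu
  obtain ⟨M, hM⟩ := hb
  have hF := hH.tonelli c a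
  set w : ℝ × ℝ → ℝ := fun z => u z.1 z.2 + z.1 * a with hw
  have hwc : ContinuousOn w {z | t₀ < z.1} :=
    (hcont.mono fun z (hz : t₀ < z.1) => ⟨hz.le, mem_univ z.2⟩).add
      (continuous_fst.mul_const a).continuousOn
  have hwsub : VSubsol (fun z q => shiftHam H c a (z.1, z.2, q)) t₀ w := hsub.vsubsol
  have hwsup : VSupersol (fun z q => shiftHam H c a (z.1, z.2, q)) t₀ w := hsup.vsupersol
  obtain ⟨L, hL0, hL⟩ := exists_lipschitz hF hwc hwsub hwsup
    (fun z hz => hM z.1 (le_of_lt hz) z.2)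
  set W : ℕ → ℝ × ℝ → ℝ := fun n z => w (z + ((n : ℝ), 0)) with hWdef
  have hlarge : ∀ b : ℝ, ∀ᶠ n : ℕ in atTop, b < n := fun b =>
    tendsto_natCast_atTop_atTop.eventually_gt_atTop b
  have hWL : EventuallyLipschitz L W := fun T => by
    filter_upwards [hlarge (t₀ + 1 - T)] with n hn z z' hz hz'
    have := hL (z + ((n : ℝ), 0)) (z' + ((n : ℝ), 0)) (by simp only [Prod.fst_add]; linarith)
      (by simp only [Prod.fst_add]; linarith)
    rwa [dist_add_right] at this
  have hvW : IsLowerLimit W fun z => v z.1 z.2 := by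
    have := isLowerLimit_liminf (W := W) (M := M) fun z => by
      filter_upwards [hlarge (t₀ - z.1)] with n hn
      exact hM _ (by simp only [mem_Ici, Prod.fst_add]; linarith) _
    convert this using 2 with z
    rw [hv]
    simp [hWdef, hw]
  have hperG : ∀ n : ℕ, (fun z : ℝ × ℝ => fun q =>
      shiftHam H c a ((z + ((n : ℝ), 0)).1, (z + ((n : ℝ), 0)).2, q)) =
      fun z q => shiftHam H c a (z.1, z.2, q) := fun n => by
    funext z q
    simpa using hF.add_int n 0 (z.1, z.2, q)
  have hWsub : ∀ T, ∀ᶠ n in atTop,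
      VSubsol (fun z q => shiftHam H c a (z.1, z.2, q)) T (W n) := fun T => by
    filter_upwards [hlarge (t₀ - T)] with n hn φ hφ z hz hmax
    have := hwsub.shift ((n : ℝ), 0)
    rw [hperG] at this
    exact this φ hφ z (by simp only; linarith) hmax
  have hWsup : ∀ T, ∀ᶠ n in atTop,
      VSupersol (fun z q => shiftHam H c a (z.1, z.2, q)) T (W n) := fun T => by
    filter_upwards [hlarge (t₀ - T)] with n hn φ hφ z hz hmin
    have := hwsup.shift ((n : ℝ), 0)
    rw [hperG] at this
    exact this φ hφ z (by simp only; linarith) hmin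
  have hFc := hF.continuous
  refine ⟨hvW.continuous hL0 hWL, fun θ x => ?_, fun θ x => ?_, ?_, ?_⟩
  · rw [hv, hv, ← liminf_nat_add (fun n : ℕ => u (θ + n) x + (θ + n) * a) 1]
    congr 1
    funext n
    have : θ + 1 + (n : ℝ) = θ + ((n + 1 : ℕ) : ℝ) := by push_cast; ring
    rw [this]
  · rw [hv, hv]
    simp only [hper]
  · intro φ hφ z _ hmax
    have := hvW.vsubsol hL0 hWL hF hWsub (z.1 - 1) φ hφ z (by linarith) hmax
    simp only [shiftHam] at this
    linarith
  · intro φ hφ z _ hmin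
    have := hvW.vsupersol hL0 hWL (by fun_prop) hWsup (z.1 - 1) φ hφ z (by linarith) hmin
    simp only [shiftHam] at this
    linarith
end
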